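/- Let (W,S) and (W̃,S̃) be Coxeter systems. Write W = W_{X_1} × ⋯ × W_{X_b} × W_{Z_3}, where W_{X_1},…,W_{X_b} are the infinite (non-spherical) irreducible components of W and W_{Z_3} is the finite part, and similarly W̃ = W̃_{X̃_1} × ⋯ × W̃_{X̃_d} × W̃_{Z̃_3}. Then W and W̃ are isomorphic as groups if and only if W_{Z_3} ≅ W̃_{Z̃_3}, b = d, and there exists a permutation σ of {1,…,b} such that W_{X_i} ≅ W̃_{X̃_{σ(i)}} for all 1 ≤ i ≤ b. -/

import Mathlib

/-!
Statement 16 (Corollary 5.4): Two Coxeter groups W = W_{X_1} × ⋯ × W_{X_b} × W_{Z_3} and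
W̃ = W̃_{X̃_1} × ⋯ × W̃_{X̃_d} × W̃_{Z̃_3} (with the W_{X_i} the infinite irreducible components
and W_{Z_3} the finite part) are isomorphic iff W_{Z_3} ≅ W̃_{Z̃_3}, b = d, and there is a
permutation σ with W_{X_i} ≅ W̃_{X̃_{σ(i)}} for all i.
-/

noncomputable section

namespace CoxeterPaper

variable {B : Type*} {W : Type*} [Group W]

/-- The Coxeter graph of `M`: vertex set `B`, with `s, t` joined by an edge iff `m_{s,t} ≥ 3`
(where `m_{s,t} = ∞` is encoded by `M s t = 0`). -/
def coxeterGraph (M : CoxeterMatrix B) : SimpleGraph B :=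
  SimpleGraph.fromRel (fun s t => M s t = 0 ∨ 3 ≤ M s t)

/-- The standard parabolic subgroup `W_X`, generated by the simple reflections indexed by `X`. -/
def standardParabolic {M : CoxeterMatrix B} (cs : CoxeterSystem M W) (X : Set B) : Subgroup W :=
  Subgroup.closure (cs.simple '' X)

section GeometricRepresentation

variable (M : CoxeterMatrix B)

/-- The symmetric bilinear form of the geometric representation. As `Real.cos (π / 0) = 1`, the
entry attached to `m_{s,t} = ∞` (encoded by `M s t = 0`) is `-1`. -/
def coxeterForm : (B →₀ ℝ) →ₗ[ℝ] (B →₀ ℝ) →ₗ[ℝ] ℝ :=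
  Finsupp.linearCombination ℝ fun s =>
    Finsupp.linearCombination ℝ fun t => -Real.cos (Real.pi / M s t)

/-- The simple root attached to `s`. -/
def simpleRoot (s : B) : B →₀ ℝ := Finsupp.single s 1

lemma coxeterForm_simpleRoot (s t : B) :
    coxeterForm M (simpleRoot s) (simpleRoot t) = -Real.cos (Real.pi / M s t) := by
  simp [coxeterForm, simpleRoot]

lemma coxeterForm_simpleRoot_self (s : B) :
    coxeterForm M (simpleRoot s) (simpleRoot s) = 1 := by
  simp [coxeterForm_simpleRoot]

lemma linearMap_ext_simpleRoot {V : Type*} [AddCommGroup V] [Module ℝ V]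
    {f g : (B →₀ ℝ) →ₗ[ℝ] V} (h : ∀ s, f (simpleRoot s) = g (simpleRoot s)) : f = g :=
  Finsupp.lhom_ext' fun s => LinearMap.ext_ring (h s)

lemma coxeterForm_comm (x y : B →₀ ℝ) : coxeterForm M x y = coxeterForm M y x := by
  have : coxeterForm M = (coxeterForm M).flip := by
    refine linearMap_ext_simpleRoot fun s => linearMap_ext_simpleRoot fun t => ?_
    simp [coxeterForm_simpleRoot, M.symmetric s t]
  exact congrArg (fun f => f x y) this

lemma two_smul_coxeterForm_simpleRoot_self (s : B) :
    ((2 : ℝ) • coxeterForm M (simpleRoot s)) (simpleRoot s) = 2 := by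
  simp [coxeterForm_simpleRoot_self]

/-- The reflection in the simple root attached to `s`. -/
def simpleReflection (s : B) : (B →₀ ℝ) ≃ₗ[ℝ] (B →₀ ℝ) :=
  Module.reflection (two_smul_coxeterForm_simpleRoot_self M s)

lemma simpleReflection_apply (s : B) (x : B →₀ ℝ) :
    simpleReflection M s x = x - (2 * coxeterForm M (simpleRoot s) x) • simpleRoot s := by
  simp [simpleReflection, Module.reflection_apply]

lemma isLiftable_simpleReflection : M.IsLiftable (simpleReflection M) := by
  intro s t
  obtain h0 | h0 := Nat.eq_zero_or_pos (M s t)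
  · simp [h0]
  by_cases hst : s = t
  · subst hst
    rw [M.diagonal, pow_one]
    ext1 x
    exact (Module.involutive_reflection (two_smul_coxeterForm_simpleRoot_self M s)) x
  have h1 : M s t ≠ 1 := M.off_diagonal s t hst
  ext1 z
  unfold simpleReflection
  rw [Module.reflection_mul_reflection_pow_apply _ _ _ _
    (2 * Real.cos (2 * (Real.pi / M s t))) (by
      simp [coxeterForm_simpleRoot, M.symmetric t s, Real.cos_two_mul]; ring)]
  obtain h2 | h3 : M s t = 2 ∨ 3 ≤ M s t := by lia
  · simp [h2, coxeterForm_simpleRoot, M.symmetric t s, mul_div_cancel₀,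
      Polynomial.Chebyshev.S_zero, Polynomial.Chebyshev.S_one]
    module
  · set θ := Real.pi / M s t with hθ
    have hm : (M s t : ℝ) * θ = Real.pi := by
      rw [hθ]; field_simp
    have hs : Real.sin (2 * θ) ≠ 0 := by
      refine (Real.sin_pos_of_pos_of_lt_pi ?_ ?_).ne'
      · positivity
      · have : (3 : ℝ) ≤ M s t := by exact_mod_cast h3
        have : 0 < θ := by positivity
        nlinarith
    have key (n : ℤ) := Polynomial.Chebyshev.S_two_mul_real_cos (2 * θ) n
    obtain ⟨k, hk | hk⟩ := Nat.even_or_odd' (M s t)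
    · have e1 : ((M s t : ℤ) - 2) / 2 = k - 1 := by lia
      have e2 : ((M s t : ℤ) - 1) / 2 = k - 1 := by lia
      have hz : (Polynomial.Chebyshev.S ℝ (k - 1)).eval (2 * Real.cos (2 * θ)) = 0 := by
        have := key (k - 1)
        have hk' : ((k : ℝ)) * (2 * θ) = Real.pi := by
          rw [← hm, hk]; push_cast; ring
        push_cast at this
        rw [sub_add_cancel, hk', Real.sin_pi] at this
        exact (mul_eq_zero.mp this).resolve_right hs
      simp [e1, e2, hz]
    · have e1 : ((M s t : ℤ) - 2) / 2 = k - 1 := by lia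
      have e2 : ((M s t : ℤ) - 1) / 2 = k := by lia
      have e3 : ((M s t : ℤ) - 3) / 2 = k - 1 := by lia
      have e4 : ((M s t : ℤ)) / 2 = k := by lia
      have hz : (Polynomial.Chebyshev.S ℝ k).eval (2 * Real.cos (2 * θ)) +
          (Polynomial.Chebyshev.S ℝ (k - 1)).eval (2 * Real.cos (2 * θ)) = 0 := by
        have h₁ := key (k - 1)
        have h₂ := key k
        have hk' : (((k : ℝ)) + 1) * (2 * θ) = 2 * Real.pi - k * (2 * θ) := by
          rw [← hm, hk]; push_cast; ring
        push_cast at h₁ h₂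
        rw [hk', Real.sin_two_pi_sub] at h₂
        rw [sub_add_cancel] at h₁
        have : ((Polynomial.Chebyshev.S ℝ k).eval (2 * Real.cos (2 * θ)) +
          (Polynomial.Chebyshev.S ℝ (k - 1)).eval (2 * Real.cos (2 * θ))) *
            Real.sin (2 * θ) = 0 := by
          linear_combination h₁ + h₂
        exact (mul_eq_zero.mp this).resolve_right hs
      simp [e1, e2, e3, e4, hz]

variable {M} (cs : CoxeterSystem M W)

/-- The geometric representation of a Coxeter system. -/
def geomRep : W →* ((B →₀ ℝ) ≃ₗ[ℝ] (B →₀ ℝ)) :=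
  cs.lift ⟨simpleReflection M, isLiftable_simpleReflection M⟩

lemma geomRep_simple (s : B) (x : B →₀ ℝ) :
    geomRep cs (cs.simple s) x =
      x - (2 * coxeterForm M (simpleRoot s) x) • simpleRoot s := by
  rw [geomRep, cs.lift_apply_simple, simpleReflection_apply]

lemma geomRep_simple_simpleRoot (s : B) :
    geomRep cs (cs.simple s) (simpleRoot s) = -simpleRoot s := by
  rw [geomRep_simple, coxeterForm_simpleRoot_self]
  module

lemma geomRep_mul_apply (v w : W) (x : B →₀ ℝ) :
    geomRep cs (v * w) x = geomRep cs v (geomRep cs w x) := by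
  rw [map_mul, LinearEquiv.mul_apply]

lemma coxeterForm_geomRep (w : W) (x y : B →₀ ℝ) :
    coxeterForm M (geomRep cs w x) (geomRep cs w y) = coxeterForm M x y := by
  induction w using cs.simple_induction_left with
  | one => simp
  | mul_simple_left w s ih =>
    rw [geomRep_mul_apply, geomRep_mul_apply, ← ih, geomRep_simple, geomRep_simple]
    simp only [map_sub, map_smul, LinearMap.sub_apply, LinearMap.smul_apply, smul_eq_mul,
      coxeterForm_simpleRoot_self, coxeterForm_comm M _ (simpleRoot s)]
    ring

/-- The `n`-th coefficient of the orbit of a simple root under the dihedral group with parameter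
`m` (infinite if `m = 0`). -/
def dihedralCoeff (m n : ℕ) : ℝ :=
  if m = 0 then n else Real.sin (n * (Real.pi / m)) / Real.sin (Real.pi / m)

lemma dihedralCoeff_zero (m : ℕ) : dihedralCoeff m 0 = 0 := by
  simp [dihedralCoeff]

lemma sin_pi_div_pos {m : ℕ} (hm : 2 ≤ m) : 0 < Real.sin (Real.pi / m) := by
  have : (2 : ℝ) ≤ m := by exact_mod_cast hm
  refine Real.sin_pos_of_pos_of_lt_pi (by positivity) ?_
  exact div_lt_self Real.pi_pos (by linarith)

lemma dihedralCoeff_one {m : ℕ} (hm : m ≠ 1) : dihedralCoeff m 1 = 1 := by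
  by_cases h0 : m = 0
  · simp [dihedralCoeff, h0]
  · have := sin_pi_div_pos (m := m) (by lia)
    simp [dihedralCoeff, h0, this.ne']

lemma dihedralCoeff_add_two (m n : ℕ) :
    dihedralCoeff m (n + 2) =
      2 * Real.cos (Real.pi / m) * dihedralCoeff m (n + 1) - dihedralCoeff m n := by
  by_cases h0 : m = 0
  · simp [dihedralCoeff, h0]; ring
  · have h := Real.sin_add_sin (((n + 2 : ℕ) : ℝ) * (Real.pi / m)) (n * (Real.pi / m))
    simp only [dihedralCoeff, h0, if_false]
    rw [show ((((n + 2 : ℕ) : ℝ) * (Real.pi / m)) + (n * (Real.pi / m))) / 2 =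
      ((n + 1 : ℕ) : ℝ) * (Real.pi / m) by push_cast; ring,
      show ((((n + 2 : ℕ) : ℝ) * (Real.pi / m)) - (n * (Real.pi / m))) / 2 =
        Real.pi / m by push_cast; ring] at h
    rw [eq_sub_iff_add_eq, ← add_div, h]
    ring

lemma dihedralCoeff_nonneg {m n : ℕ} (h : m = 0 ∨ n ≤ m) : 0 ≤ dihedralCoeff m n := by
  by_cases h0 : m = 0
  · simp [dihedralCoeff, h0]
  · have hnm : (n : ℝ) ≤ m := by exact_mod_cast h.resolve_left h0
    have h1 : (1 : ℝ) ≤ m := by exact_mod_cast Nat.one_le_iff_ne_zero.mpr h0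
    simp only [dihedralCoeff, h0, if_false]
    refine div_nonneg (Real.sin_nonneg_of_nonneg_of_le_pi (by positivity) ?_)
      (Real.sin_nonneg_of_nonneg_of_le_pi (by positivity) (div_le_self Real.pi_pos.le h1))
    rw [mul_div_left_comm]
    exact mul_le_of_le_one_right Real.pi_pos.le (div_le_one_of_le₀ hnm (by positivity))

open CoxeterSystem in
lemma geomRep_alternatingWord_simpleRoot {s t : B} (hst : s ≠ t) (n : ℕ) :
    geomRep cs (cs.wordProd (alternatingWord s t n)) (simpleRoot s) =
      if Even n then
        dihedralCoeff (M s t) (n + 1) • simpleRoot s + dihedralCoeff (M s t) n • simpleRoot t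
      else
        dihedralCoeff (M s t) n • simpleRoot s + dihedralCoeff (M s t) (n + 1) • simpleRoot t := by
  induction n with
  | zero =>
    simp [alternatingWord, dihedralCoeff_zero, dihedralCoeff_one (M.off_diagonal s t hst)]
  | succ n ih =>
    rw [alternatingWord_succ', cs.wordProd_cons, geomRep_mul_apply, ih]
    by_cases hn : Even n
    · simp only [hn, if_true, Nat.even_add_one, not_true_eq_false, if_false, geomRep_simple,
        map_add, map_smul, coxeterForm_simpleRoot, M.symmetric t s, dihedralCoeff_add_two]
      simp
      module
    · simp only [hn, if_true, Nat.even_add_one, not_false_eq_true, if_false, geomRep_simple,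
        map_add, map_smul, coxeterForm_simpleRoot, dihedralCoeff_add_two]
      simp
      module

end GeometricRepresentation

section PositiveRoots

variable {M : CoxeterMatrix B} (cs : CoxeterSystem M W)

open CoxeterSystem in
lemma exists_alternatingWord_add (s t : B) (m j : ℕ) :
    ∃ L : List B, L.length = j ∧ alternatingWord s t (m + j) = L ++ alternatingWord s t m := by
  induction j with
  | zero => exact ⟨[], rfl, rfl⟩
  | succ j ih =>
    obtain ⟨L, hL, h⟩ := ih
    refine ⟨(if Even (m + j) then t else s) :: L, by rw [List.length_cons, hL], ?_⟩
    rw [← add_assoc, alternatingWord_succ', h, List.cons_append]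

open CoxeterSystem in
lemma length_alternatingWord_mul_simple_lt {s t : B} {n : ℕ} (h0 : M s t ≠ 0) (hn : M s t ≤ n) :
    cs.length (cs.wordProd (alternatingWord s t n) * cs.simple s) < n := by
  obtain ⟨m, hm⟩ := Nat.exists_eq_succ_of_ne_zero h0
  obtain ⟨L, hL, h⟩ := exists_alternatingWord_add s t (M s t) (n - M s t)
  have hbraid : cs.wordProd (alternatingWord s t (M s t)) =
      cs.wordProd (alternatingWord s t m) * cs.simple s := by
    have := cs.wordProd_braidWord_eq s t
    rw [braidWord, braidWord, M.symmetric t s] at this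
    rw [this, hm, alternatingWord_succ, cs.wordProd_concat]
  rw [Nat.add_sub_cancel' hn] at h
  rw [h, cs.wordProd_append, hbraid, mul_assoc, mul_assoc, cs.simple_mul_simple_self, mul_one,
    ← cs.wordProd_append]
  refine (cs.length_wordProd_le _).trans_lt ?_
  rw [List.length_append, hL, length_alternatingWord]
  lia

open CoxeterSystem in
/-- An element not sent below in length by right multiplication by `s` maps the simple root of `s`
to a positive root. -/
theorem geomRep_simpleRoot_nonneg (w : W) (s : B)
    (h : cs.length w < cs.length (w * cs.simple s)) :
    0 ≤ geomRep cs w (simpleRoot s) := by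
  induction hN : cs.length w using Nat.strong_induction_on generalizing w s with
  | _ N ih =>
  subst hN
  by_cases hw : w = 1
  · subst hw
    simp [simpleRoot]
  obtain ⟨t, ht⟩ := cs.exists_rightDescent_of_ne_one hw
  have hst : s ≠ t := by
    rintro rfl
    exact lt_asymm h ht
  have hex : ∃ k : ℕ, (∃ v, w = v * cs.wordProd (alternatingWord s t (k + 1)) ∧
        cs.length v + (k + 1) = cs.length w) ∧
      ¬ ∃ v, w = v * cs.wordProd (alternatingWord s t (k + 2)) ∧
        cs.length v + (k + 2) = cs.length w := by
    by_contra! hcon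
    have hall : ∀ k : ℕ, ∃ v, w = v * cs.wordProd (alternatingWord s t (k + 1)) ∧
        cs.length v + (k + 1) = cs.length w := by
      intro k
      induction k with
      | zero =>
        refine ⟨w * cs.simple t, ?_, cs.isRightDescent_iff.mp ht⟩
        simp [alternatingWord]
      | succ k ihk =>
        obtain ⟨v, hv⟩ := hcon k ihk
        exact ⟨v, hv⟩
    obtain ⟨v, -, hv⟩ := hall (cs.length w)
    lia
  obtain ⟨k, ⟨v, hwv, hlen⟩, hmax⟩ := hex
  have hfirst : cs.length v < cs.length (v * cs.simple (if Even k then t else s)) := by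
    have : w = v * cs.simple (if Even k then t else s) *
        cs.wordProd (alternatingWord s t k) := by
      rw [mul_assoc, ← cs.wordProd_cons, ← alternatingWord_succ', hwv]
    have h1 := cs.length_mul_le (v * cs.simple (if Even k then t else s))
      (cs.wordProd (alternatingWord s t k))
    rw [← this] at h1
    have h2 := cs.length_wordProd_le (alternatingWord s t k)
    rw [length_alternatingWord] at h2
    lia
  have hsecond : cs.length v < cs.length (v * cs.simple (if Even (k + 1) then t else s)) := by
    by_contra hcon
    refine hmax ⟨v * cs.simple (if Even (k + 1) then t else s), ?_, ?_⟩
    · rw [alternatingWord_succ', cs.wordProd_cons, mul_assoc, cs.simple_mul_simple_cancel_left, hwv]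
    · obtain h' | h' := cs.length_mul_simple v (if Even (k + 1) then t else s) <;> lia
  have hvs : 0 ≤ geomRep cs v (simpleRoot s) ∧ 0 ≤ geomRep cs v (simpleRoot t) := by
    have h1 := ih (cs.length v) (by lia) v _ hfirst rfl
    have h2 := ih (cs.length v) (by lia) v _ hsecond rfl
    by_cases hk : Even k
    · simp only [hk, Nat.even_add_one, if_true, not_true_eq_false, if_false] at h1 h2
      exact ⟨h2, h1⟩
    · simp only [hk, Nat.even_add_one, if_true, not_false_eq_true, if_false] at h1 h2
      exact ⟨h1, h2⟩
  have hbound : M s t = 0 ∨ k + 2 ≤ M s t := by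
    by_contra! hcon
    have h1 := length_alternatingWord_mul_simple_lt cs hcon.1 (Nat.lt_succ_iff.mp hcon.2)
    have h2 := cs.length_mul_le v (cs.wordProd (alternatingWord s t (k + 1)) * cs.simple s)
    rw [← mul_assoc, ← hwv] at h2
    lia
  have hc1 : 0 ≤ dihedralCoeff (M s t) (k + 1) := dihedralCoeff_nonneg (by lia)
  have hc2 : 0 ≤ dihedralCoeff (M s t) (k + 2) := dihedralCoeff_nonneg (by lia)
  rw [hwv, geomRep_mul_apply, geomRep_alternatingWord_simpleRoot cs hst]
  split_ifs <;> rw [map_add, map_smul, map_smul]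
  · exact add_nonneg (smul_nonneg hc2 hvs.1) (smul_nonneg hc1 hvs.2)
  · exact add_nonneg (smul_nonneg hc1 hvs.1) (smul_nonneg hc2 hvs.2)

lemma geomRep_simpleRoot_nonpos (w : W) (s : B)
    (h : cs.length (w * cs.simple s) < cs.length w) :
    geomRep cs w (simpleRoot s) ≤ 0 := by
  have := geomRep_simpleRoot_nonneg cs (w * cs.simple s) s (by
    rwa [mul_assoc, cs.simple_mul_simple_self, mul_one])
  rw [geomRep_mul_apply, geomRep_simple_simpleRoot, map_neg] at this
  exact neg_nonneg.mp this

lemma geomRep_simpleRoot_nonneg_or_nonpos (w : W) (s : B) :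
    0 ≤ geomRep cs w (simpleRoot s) ∨ geomRep cs w (simpleRoot s) ≤ 0 := by
  obtain h | h := cs.length_mul_simple w s
  · exact .inl (geomRep_simpleRoot_nonneg cs w s (by lia))
  · exact .inr (geomRep_simpleRoot_nonpos cs w s (by lia))

/-- The geometric representation is faithful. -/
theorem geomRep_injective : Function.Injective (geomRep cs) := by
  rw [injective_iff_map_eq_one]
  intro w hw
  by_contra hne
  obtain ⟨s, hs⟩ := cs.exists_rightDescent_of_ne_one hne
  have h := geomRep_simpleRoot_nonpos cs w s hs s
  rw [hw] at h
  simp [simpleRoot] at h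
  linarith

/-- A root of the geometric representation. -/
def IsRoot (x : B →₀ ℝ) : Prop := ∃ w s, x = geomRep cs w (simpleRoot s)

/-- The set of positive roots. -/
def positiveRoots : Set (B →₀ ℝ) := {x | IsRoot cs x ∧ 0 ≤ x}

variable {cs}

lemma IsRoot.nonneg_or_nonpos {x : B →₀ ℝ} (hx : IsRoot cs x) : 0 ≤ x ∨ x ≤ 0 := by
  obtain ⟨w, s, rfl⟩ := hx
  exact geomRep_simpleRoot_nonneg_or_nonpos cs w s

lemma IsRoot.geomRep {x : B →₀ ℝ} (hx : IsRoot cs x) (w : W) :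
    IsRoot cs (geomRep cs w x) := by
  obtain ⟨v, s, rfl⟩ := hx
  exact ⟨w * v, s, (geomRep_mul_apply cs w v _).symm⟩

lemma IsRoot.neg {x : B →₀ ℝ} (hx : IsRoot cs x) : IsRoot cs (-x) := by
  obtain ⟨v, s, rfl⟩ := hx
  exact ⟨v * cs.simple s, s, by rw [geomRep_mul_apply, geomRep_simple_simpleRoot, map_neg]⟩

lemma IsRoot.coxeterForm_self {x : B →₀ ℝ} (hx : IsRoot cs x) : coxeterForm M x x = 1 := by
  obtain ⟨w, s, rfl⟩ := hx
  rw [coxeterForm_geomRep, coxeterForm_simpleRoot_self]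

lemma IsRoot.ne_zero {x : B →₀ ℝ} (hx : IsRoot cs x) : x ≠ 0 := by
  rintro rfl
  simpa using hx.coxeterForm_self

lemma IsRoot.simple_nonneg {x : B →₀ ℝ} (hx : IsRoot cs x) (h : 0 ≤ x) {s : B}
    (hs : x ≠ simpleRoot s) : 0 ≤ CoxeterPaper.geomRep cs (cs.simple s) x := by
  obtain ⟨t, hts, ht⟩ : ∃ t, t ≠ s ∧ 0 < x t := by
    by_contra! hcon
    have hxs : x = x s • simpleRoot s := by
      ext t
      by_cases hts : t = s
      · simp [hts, simpleRoot]
      · simpa [simpleRoot, Finsupp.single_eq_of_ne hts] using le_antisymm (hcon t hts) (h t)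
    have h1 := hx.coxeterForm_self
    rw [hxs] at h1
    simp only [map_smul, LinearMap.smul_apply, coxeterForm_simpleRoot_self, smul_eq_mul,
      mul_one] at h1
    have h2 : x s = 1 := by
      have h0 : 0 ≤ x s := h s
      nlinarith
    rw [h2, one_smul] at hxs
    exact hs hxs
  refine (hx.geomRep (cs.simple s)).nonneg_or_nonpos.resolve_right fun hneg => ?_
  have := hneg t
  rw [geomRep_simple] at this
  simp [simpleRoot, Finsupp.single_eq_of_ne hts] at this
  linarith

variable (cs)

lemma finite_positiveRoots_not_nonneg (w : W) :
    {x ∈ positiveRoots cs | ¬ 0 ≤ geomRep cs w x}.Finite := by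
  induction w using cs.simple_induction_left with
  | one =>
    convert Set.finite_empty
    ext x
    simp +contextual [positiveRoots]
  | mul_simple_left w s ih =>
    refine (ih.union (Set.finite_singleton ((geomRep cs w)⁻¹ (simpleRoot s)))).subset ?_
    rintro x ⟨hx, hneg⟩
    by_cases h0 : 0 ≤ geomRep cs w x
    · right
      by_contra hne
      refine hneg ?_
      rw [geomRep_mul_apply]
      refine (hx.1.geomRep w).simple_nonneg h0 fun h => hne ?_
      rw [Set.mem_singleton_iff, ← h]
      exact ((geomRep cs w).symm_apply_apply x).symm
    · exact .inl ⟨hx, h0⟩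

lemma infinite_positiveRoots [Finite B] [Infinite W] : (positiveRoots cs).Infinite := by
  intro hfin
  have hroots : {x | IsRoot cs x}.Finite := by
    refine (hfin.union (hfin.image Neg.neg)).subset fun x hx => ?_
    obtain h | h := hx.nonneg_or_nonpos
    · exact .inl ⟨hx, h⟩
    · exact .inr ⟨-x, ⟨hx.neg, neg_nonneg.mpr h⟩, neg_neg x⟩
  have := hroots.to_subtype
  let f : W → B → {x | IsRoot cs x} := fun w s => ⟨geomRep cs w (simpleRoot s), w, s, rfl⟩
  refine not_injective_infinite_finite f fun v w hvw => geomRep_injective cs ?_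
  refine LinearEquiv.toLinearMap_injective (linearMap_ext_simpleRoot fun s => ?_)
  exact congrArg Subtype.val (congrFun hvw s)

end PositiveRoots

section Irreducible

variable {M : CoxeterMatrix B} (cs : CoxeterSystem M W)

lemma coxeterForm_simpleRoot_ne_zero {s t : B} (h : (coxeterGraph M).Adj s t) :
    coxeterForm M (simpleRoot s) (simpleRoot t) ≠ 0 := by
  have hM : M s t = 0 ∨ 3 ≤ M s t := by
    have := h
    rw [coxeterGraph, SimpleGraph.fromRel_adj, M.symmetric t s, or_self] at this
    exact this.2
  rw [coxeterForm_simpleRoot, neg_ne_zero]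
  obtain h0 | h3 := hM
  · simp [h0]
  · have h3' : (3 : ℝ) ≤ M s t := by exact_mod_cast h3
    refine (Real.cos_pos_of_mem_Ioo ⟨?_, ?_⟩).ne'
    · have : 0 < Real.pi / M s t := by positivity
      linarith [Real.pi_pos]
    · exact div_lt_div_of_pos_left Real.pi_pos (by norm_num) (by linarith)

lemma forall_of_preconnected {V : Type*} {G : SimpleGraph V} (hG : G.Preconnected) {p : V → Prop}
    {s : V} (hs : p s) (hp : ∀ t u, G.Adj t u → p t → p u) (t : V) : p t := by
  obtain ⟨q⟩ := hG s t
  induction q with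
  | nil => exact hs
  | cons h _ ih => exact ih (hp _ _ h hs)

lemma geomRep_eq_one_iff {w : W} : (∀ x, geomRep cs w x = x) ↔ w = 1 := by
  refine ⟨fun h => geomRep_injective cs ?_, by rintro rfl x; simp⟩
  rw [map_one]
  exact LinearEquiv.ext h

lemma geomRep_inv_apply_self (w : W) (x : B →₀ ℝ) :
    geomRep cs w⁻¹ (geomRep cs w x) = x := by
  rw [← geomRep_mul_apply]
  simp

lemma coxeterForm_geomRep_left (w : W) (x y : B →₀ ℝ) :
    coxeterForm M (geomRep cs w x) y = coxeterForm M x (geomRep cs w⁻¹ y) := by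
  rw [← coxeterForm_geomRep cs w x (geomRep cs w⁻¹ y), ← geomRep_mul_apply]
  simp

lemma coxeterForm_geomRep_congr {x y : B →₀ ℝ} {c : ℝ}
    (h : coxeterForm M x = c • coxeterForm M y) (w : W) :
    coxeterForm M (geomRep cs w x) = c • coxeterForm M (geomRep cs w y) := by
  refine LinearMap.ext fun z => ?_
  rw [LinearMap.smul_apply, coxeterForm_geomRep_left, h, coxeterForm_geomRep_left,
    LinearMap.smul_apply]

/-- The radical of the form is fixed pointwise by the geometric representation. -/
lemma geomRep_of_coxeterForm_eq_zero {x : B →₀ ℝ} (hx : coxeterForm M x = 0) (w : W) :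
    geomRep cs w x = x := by
  induction w using cs.simple_induction_left with
  | one => simp
  | mul_simple_left w s ih =>
    rw [geomRep_mul_apply, ih, geomRep_simple, coxeterForm_comm, hx]
    simp

lemma eq_smul_of_commute_geomRep (hM : (coxeterGraph M).Preconnected)
    (φ : (B →₀ ℝ) →ₗ[ℝ] (B →₀ ℝ))
    (hφ : ∀ w x, φ (geomRep cs w x) = geomRep cs w (φ x)) :
    ∃ c : ℝ, ∀ x, φ x = c • x := by
  obtain hB | ⟨⟨s⟩⟩ := isEmpty_or_nonempty B
  · exact ⟨0, fun x => Subsingleton.elim _ _⟩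
  have key (t : B) : φ (simpleRoot t) =
      coxeterForm M (simpleRoot t) (φ (simpleRoot t)) • simpleRoot t := by
    have h := hφ (cs.simple t) (simpleRoot t)
    rw [geomRep_simple_simpleRoot, geomRep_simple, map_neg] at h
    have h2 : (2 : ℝ) • φ (simpleRoot t) =
      (2 : ℝ) • coxeterForm M (simpleRoot t) (φ (simpleRoot t)) • simpleRoot t := by
      linear_combination (norm := module) -h
    exact smul_right_injective _ two_ne_zero h2
  refine ⟨coxeterForm M (simpleRoot s) (φ (simpleRoot s)), fun x => ?_⟩
  suffices φ = coxeterForm M (simpleRoot s) (φ (simpleRoot s)) • LinearMap.id by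
    rw [this]; simp [coxeterForm_simpleRoot_self]
  refine linearMap_ext_simpleRoot fun t => ?_
  rw [LinearMap.smul_apply, LinearMap.id_apply]
  refine forall_of_preconnected hM (p := fun t => φ (simpleRoot t) =
    coxeterForm M (simpleRoot s) (φ (simpleRoot s)) • simpleRoot t) (key s) ?_ t
  intro t u htu ht
  have h := hφ (cs.simple u) (simpleRoot t)
  rw [ht, map_smul, geomRep_simple, map_sub, ht, map_smul, smul_sub, sub_right_inj, smul_comm] at h
  exact smul_right_injective _
    (mul_ne_zero two_ne_zero (coxeterForm_simpleRoot_ne_zero htu.symm)) h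

/-- A finite normal subgroup of an infinite irreducible Coxeter group is trivial. -/
theorem eq_bot_of_finite_normal {M : CoxeterMatrix B} (cs : CoxeterSystem M W) [Finite B]
    [Infinite W] (hM : (coxeterGraph M).Preconnected)
    (N : Subgroup W) [N.Normal] [Finite N] : N = ⊥ := by
  have := Fintype.ofFinite N
  let φ : (B →₀ ℝ) →ₗ[ℝ] (B →₀ ℝ) := ∑ n : N, (geomRep cs (n : W)).toLinearMap
  have hφ (x : B →₀ ℝ) : φ x = ∑ n : N, geomRep cs (n : W) x := by simp [φ]
  obtain ⟨c, hc⟩ := eq_smul_of_commute_geomRep cs hM φ fun w x => by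
    rw [hφ, hφ, map_sum, ← Equiv.sum_comp (MulAut.conjNormal w).toEquiv]
    refine Finset.sum_congr rfl fun n _ => ?_
    simp only [← geomRep_mul_apply]
    simp
  by_cases h0 : c = 0
  · exfalso
    refine infinite_positiveRoots cs ((Set.finite_iUnion fun n : N =>
      finite_positiveRoots_not_nonneg cs (n : W)).subset fun x hx => ?_)
    by_contra hcon
    simp only [Set.mem_iUnion, Set.mem_ofPred_eq, not_exists, not_and, not_not] at hcon
    have hsum : ∑ n : N, geomRep cs (n : W) x = 0 := by
      rw [← hφ, hc, h0, zero_smul]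
    rw [Finset.sum_eq_zero_iff_of_nonneg fun n _ => hcon n hx] at hsum
    exact (hx.1.geomRep 1).ne_zero (hsum 1 (Finset.mem_univ _))
  · rw [Subgroup.eq_bot_iff_forall]
    intro m hm
    rw [← geomRep_eq_one_iff cs]
    intro x
    have h : geomRep cs m (φ x) = φ x := by
      rw [hφ, map_sum]
      exact Fintype.sum_equiv (Equiv.mulLeft (⟨m, hm⟩ : N)) _ _ fun n => by simp
    rw [hc, map_smul] at h
    exact smul_right_injective _ h0 h

/-- The center of an infinite irreducible Coxeter group is trivial. -/
theorem eq_one_of_forall_commute {M : CoxeterMatrix B} (cs : CoxeterSystem M W) [Finite B]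
    [Infinite W] (hM : (coxeterGraph M).Preconnected)
    {z : W} (hz : ∀ w, Commute z w) : z = 1 := by
  obtain ⟨c, hc⟩ := eq_smul_of_commute_geomRep cs hM (geomRep cs z).toLinearMap fun w x => by
    simp only [LinearEquiv.coe_coe, ← geomRep_mul_apply, (hz w).eq]
  replace hc (x : B →₀ ℝ) : geomRep cs z x = c • x := hc x
  obtain hB | ⟨⟨s⟩⟩ := isEmpty_or_nonempty B
  · exact (geomRep_eq_one_iff cs).mp fun x => Subsingleton.elim _ _
  have hcc : c * c = 1 := by
    have := coxeterForm_geomRep cs z (simpleRoot s) (simpleRoot s)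
    simpa [hc, coxeterForm_simpleRoot_self] using this
  have hz2 : z ^ 2 = 1 := by
    rw [← geomRep_eq_one_iff cs]
    intro x
    rw [pow_two, geomRep_mul_apply, hc, hc, smul_smul, hcc, one_smul]
  have hN : (Subgroup.zpowers z).Normal := by
    refine ⟨fun x hx g => ?_⟩
    obtain ⟨k, rfl⟩ := hx
    have : g * z ^ k * g⁻¹ = z ^ k := by
      rw [← ((hz g).zpow_left k).eq, mul_inv_cancel_right]
    simp only [this]
    exact ⟨k, rfl⟩
  have hfin : Finite (Subgroup.zpowers z) :=
    (isOfFinOrder_iff_pow_eq_one.mpr ⟨2, two_pos, hz2⟩).finite_zpowers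
  exact Subgroup.zpowers_eq_bot.mp (eq_bot_of_finite_normal cs hM (Subgroup.zpowers z))

lemma finite_of_forall_eq_or_eq {M : CoxeterMatrix B} (cs : CoxeterSystem M W) {s t : B}
    (hB : ∀ u, u = s ∨ u = t) (hM : M s t ≠ 0) :
    Finite W := by
  set x := cs.simple s * cs.simple t with hx
  have hfin : (Subgroup.zpowers x : Set W).Finite := by
    refine (isOfFinOrder_iff_pow_eq_one.mpr ⟨M s t, Nat.pos_of_ne_zero hM, ?_⟩).finite_zpowers
    exact cs.simple_mul_simple_pow s t
  have hinv : x⁻¹ = cs.simple t * cs.simple s := by simp [hx]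
  have hs (k : ℤ) : cs.simple s * x ^ k = x ^ (-k) * cs.simple s := by
    have : SemiconjBy (cs.simple s) x x⁻¹ := by
      rw [SemiconjBy, hinv, hx, cs.simple_mul_simple_cancel_left, mul_assoc,
        cs.simple_mul_simple_self, mul_one]
    rw [zpow_neg, ← inv_zpow]
    exact this.zpow_right k
  have ht : cs.simple t = cs.simple s * x := by
    rw [hx, cs.simple_mul_simple_cancel_left]
  refine Set.finite_univ_iff.mp ((hfin.union (hfin.image (· * cs.simple s))).subset
    fun w _ => ?_)
  have hclosed : ∀ w : W, (w ∈ Subgroup.zpowers x ∨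
      ∃ y ∈ Subgroup.zpowers x, y * cs.simple s = w) → (cs.simple s * w ∈ Subgroup.zpowers x ∨
      ∃ y ∈ Subgroup.zpowers x, y * cs.simple s = cs.simple s * w) := by
    rintro w (⟨k, rfl⟩ | ⟨_, ⟨k, rfl⟩, rfl⟩)
    · exact .inr ⟨x ^ (-k), ⟨-k, rfl⟩, (hs k).symm⟩
    · refine .inl ⟨-k, ?_⟩
      simp only
      rw [← mul_assoc, hs, mul_assoc, cs.simple_mul_simple_self, mul_one]
  have hall : w ∈ Subgroup.zpowers x ∨ ∃ y ∈ Subgroup.zpowers x, y * cs.simple s = w := by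
    induction w using cs.simple_induction_left with
    | one => exact .inl (one_mem _)
    | mul_simple_left w u ih =>
      obtain rfl | rfl := hB u
      · exact hclosed w (ih trivial)
      · rw [ht, mul_assoc]
        refine hclosed _ ?_
        obtain h | ⟨y, hy, hyw⟩ := ih trivial
        · exact .inl (mul_mem (Subgroup.mem_zpowers x) h)
        · exact .inr ⟨x * y, mul_mem (Subgroup.mem_zpowers x) hy, by rw [mul_assoc, hyw]⟩
  exact hall

end Irreducible

/-- `N` and `K` centralize each other and generate the group. -/
def IsCommutingFactorization {G : Type*} [Group G] (N K : Subgroup G) : Prop :=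
  (∀ n ∈ N, ∀ k ∈ K, Commute n k) ∧ ∀ g, ∃ n ∈ N, ∃ k ∈ K, g = n * k

lemma IsCommutingFactorization.symm {G : Type*} [Group G] {N K : Subgroup G}
    (h : IsCommutingFactorization N K) : IsCommutingFactorization K N := by
  refine ⟨fun k hk n hn => (h.1 n hn k hk).symm, fun g => ?_⟩
  obtain ⟨n, hn, k, hk, rfl⟩ := h.2 g
  exact ⟨k, hk, n, hn, h.1 n hn k hk⟩

section Indecomposable

variable {M : CoxeterMatrix B}

/-- Two vectors are parallel modulo the radical of the form. -/
def FormParallel (M : CoxeterMatrix B) (x y : B →₀ ℝ) : Prop :=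
  ∃ c : ℝ, coxeterForm M x = c • coxeterForm M y

lemma FormParallel.symm {x y : B →₀ ℝ} (h : FormParallel M x y) (hx : coxeterForm M x x = 1) :
    FormParallel M y x := by
  obtain ⟨c, hc⟩ := h
  have h0 : c ≠ 0 := by
    rintro rfl
    simp [hc] at hx
  exact ⟨c⁻¹, by rw [hc, inv_smul_smul₀ h0]⟩

lemma exists_coxeterForm_eq_zero_and_eq_one {x y : B →₀ ℝ} (h : ¬ FormParallel M x y)
    (hy : coxeterForm M y y = 1) : ∃ z, coxeterForm M y z = 0 ∧ coxeterForm M x z = 1 := by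
  obtain ⟨z, hz0, hz⟩ : ∃ z, coxeterForm M y z = 0 ∧ coxeterForm M x z ≠ 0 := by
    by_contra! hcon
    refine h ⟨coxeterForm M x y, LinearMap.ext fun z => ?_⟩
    have := hcon (z - coxeterForm M y z • y) (by simp [hy])
    rw [map_sub, map_smul, smul_eq_mul, sub_eq_zero] at this
    rw [this, LinearMap.smul_apply, smul_eq_mul, mul_comm]
  exact ⟨(coxeterForm M x z)⁻¹ • z, by simp [hz0], by simp [hz]⟩

lemma eq_top_of_simpleRoot_mem {U : Submodule ℝ (B →₀ ℝ)} (h : ∀ t, simpleRoot t ∈ U) : U = ⊤ := by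
  refine eq_top_iff.mpr fun x _ => ?_
  induction x using Finsupp.induction_linear with
  | zero => exact zero_mem _
  | add x y hx hy => exact add_mem (hx trivial) (hy trivial)
  | single t a =>
    have : Finsupp.single t a = a • simpleRoot t := by simp [simpleRoot]
    exact this ▸ U.smul_mem a (h t)

variable (cs : CoxeterSystem M W)

lemma coxeterForm_geomRep_simpleRoot_self (w : W) (s : B) :
    coxeterForm M (geomRep cs w (simpleRoot s)) (geomRep cs w (simpleRoot s)) = 1 := by
  rw [coxeterForm_geomRep, coxeterForm_simpleRoot_self]

lemma eq_top_of_orbit_subset (hM : (coxeterGraph M).Preconnected) {U : Submodule ℝ (B →₀ ℝ)} {s : B}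
    (h : ∀ w, geomRep cs w (simpleRoot s) ∈ U) : U = ⊤ := by
  refine eq_top_of_simpleRoot_mem fun t => ?_
  have := forall_of_preconnected hM (p := fun t => ∀ w, geomRep cs w (simpleRoot t) ∈ U) h
    (fun t u htu ht w => ?_) t 1
  · simpa using this
  have h1 := ht (w * cs.simple u)
  rw [geomRep_mul_apply, geomRep_simple, map_sub, map_smul,
    Submodule.sub_mem_iff_right _ (ht w)] at h1
  exact (U.smul_mem_iff (mul_ne_zero two_ne_zero (coxeterForm_simpleRoot_ne_zero htu.symm))).mp h1

lemma geomRep_simple_conj (w : W) (s : B) (x : B →₀ ℝ) :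
    geomRep cs (w * cs.simple s * w⁻¹) x =
      x - (2 * coxeterForm M (geomRep cs w (simpleRoot s)) x) • geomRep cs w (simpleRoot s) := by
  rw [geomRep_mul_apply, geomRep_mul_apply, geomRep_simple, map_sub, map_smul,
    ← geomRep_mul_apply, ← coxeterForm_geomRep_left]
  simp

lemma geomRep_simpleRoot_of_commute {w : W} {s : B} (h : Commute w (cs.simple s)) :
    geomRep cs w (simpleRoot s) =
      coxeterForm M (simpleRoot s) (geomRep cs w (simpleRoot s)) • simpleRoot s := by
  have h1 : geomRep cs (w * cs.simple s) (simpleRoot s) =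
    geomRep cs (cs.simple s * w) (simpleRoot s) := by rw [h.eq]
  rw [geomRep_mul_apply, geomRep_mul_apply, geomRep_simple_simpleRoot, geomRep_simple, map_neg]
    at h1
  refine smul_right_injective _ (two_ne_zero (α := ℝ)) ?_
  linear_combination (norm := module) -h1

variable {cs} {N K : Subgroup W}

lemma IsCommutingFactorization.coxeterForm_smul_add (h : IsCommutingFactorization N K) (s : B)
    {n k : W} (hn : n ∈ N) (hk : k ∈ K) (x : B →₀ ℝ) :
    coxeterForm M (geomRep cs n (simpleRoot s)) x • geomRep cs n (simpleRoot s) +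
      coxeterForm M (geomRep cs k (simpleRoot s)) x • geomRep cs k (simpleRoot s) =
    coxeterForm M (simpleRoot s) x • simpleRoot s +
      coxeterForm M (geomRep cs (n * k) (simpleRoot s)) x • geomRep cs (n * k) (simpleRoot s) := by
  obtain ⟨n₀, hn₀, k₀, hk₀, hs⟩ := h.2 (cs.simple s)
  have hcomm : Commute k₀ (cs.simple s) := by
    rw [hs]
    exact (h.1 n₀ hn₀ k₀ hk₀).symm.mul_right (Commute.refl k₀)
  set δ := coxeterForm M (simpleRoot s) (geomRep cs k₀ (simpleRoot s)) with hδ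
  have hk₀s : geomRep cs k₀ (simpleRoot s) = δ • simpleRoot s :=
    geomRep_simpleRoot_of_commute cs hcomm
  have hδδ : δ * δ = 1 := by
    have := coxeterForm_geomRep_simpleRoot_self cs k₀ s
    simpa [hk₀s, coxeterForm_simpleRoot_self] using this
  have key (n k : W) (hn : n ∈ N) (hk : k ∈ K) : geomRep cs (n * n₀ * n⁻¹) x =
      geomRep cs (k * k₀⁻¹ * k⁻¹) x -
        (2 * δ * coxeterForm M (geomRep cs (n * k) (simpleRoot s)) x) •
          geomRep cs (n * k) (simpleRoot s) := by
    have e1 : n * n₀ * n⁻¹ = (n * k) * cs.simple s * (n * k)⁻¹ * (k * k₀⁻¹ * k⁻¹) := by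
      have a1 : k * (n₀ * n⁻¹) = n₀ * n⁻¹ * k := (h.1 _ (mul_mem hn₀ (inv_mem hn)) k hk).symm
      have a2 : k₀ * n⁻¹ = n⁻¹ * k₀ := (h.1 _ (inv_mem hn) k₀ hk₀).symm
      have a3 : (n * k)⁻¹ = n⁻¹ * k⁻¹ := by rw [(h.1 n hn k hk).eq, mul_inv_rev]
      calc n * n₀ * n⁻¹ = n * (n₀ * n⁻¹ * k) * k⁻¹ := by group
        _ = n * k * n₀ * (n⁻¹ * k₀) * k⁻¹ * (k * k₀⁻¹ * k⁻¹) := by rw [← a1]; group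
        _ = _ := by rw [← a2, hs, a3]; group
    have e2 : k * k₀ * k⁻¹ * (n * k) = n * k * k₀ := by
      have := (h.1 n hn (k * k₀ * k⁻¹) (mul_mem (mul_mem hk hk₀) (inv_mem hk))).eq
      rw [← mul_assoc, ← this]
      group
    rw [e1, geomRep_mul_apply, geomRep_simple_conj]
    have e3 : coxeterForm M (geomRep cs (n * k) (simpleRoot s))
        (geomRep cs (k * k₀⁻¹ * k⁻¹) x) =
          δ * coxeterForm M (geomRep cs (n * k) (simpleRoot s)) x := by
      have : k * k₀⁻¹ * k⁻¹ = (k * k₀ * k⁻¹)⁻¹ := by group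
      rw [this, ← coxeterForm_geomRep_left, ← geomRep_mul_apply, e2, geomRep_mul_apply cs (n * k),
        hk₀s, map_smul, map_smul, LinearMap.smul_apply, smul_eq_mul]
    rw [e3, ← mul_assoc 2]
  have k1 := key n k hn hk
  have k2 := key n 1 hn (one_mem _)
  have k3 := key 1 k (one_mem _) hk
  have k4 := key 1 1 (one_mem _) (one_mem _)
  simp only [mul_one, one_mul, inv_one, map_one, LinearEquiv.coe_one, id_eq] at k1 k2 k3 k4
  have h2 : (2 * δ) • (coxeterForm M (geomRep cs n (simpleRoot s)) x • geomRep cs n (simpleRoot s) +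
      coxeterForm M (geomRep cs k (simpleRoot s)) x • geomRep cs k (simpleRoot s)) =
    (2 * δ) • (coxeterForm M (simpleRoot s) x • simpleRoot s +
      coxeterForm M (geomRep cs (n * k) (simpleRoot s)) x •
        geomRep cs (n * k) (simpleRoot s)) := by
    linear_combination (norm := module) k2 + k3 - k1 - k4
  refine smul_right_injective _ (mul_ne_zero two_ne_zero ?_) h2
  rintro h0
  simp [h0] at hδδ

end Indecomposable

section Indecomposable

variable {M : CoxeterMatrix B} {cs : CoxeterSystem M W} {N K : Subgroup W}

lemma mul_mul_coxeterForm_eq {w : W} {x y : B →₀ ℝ} {a c : ℝ}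
    (hx : coxeterForm M (geomRep cs w x) = a • coxeterForm M x)
    (hy : coxeterForm M (geomRep cs w y) = c • coxeterForm M y) :
    a * (c * coxeterForm M x y) = coxeterForm M x y := by
  have := coxeterForm_geomRep cs w x y
  rwa [hx, LinearMap.smul_apply, coxeterForm_comm M x, hy, LinearMap.smul_apply,
    coxeterForm_comm M y, smul_eq_mul, smul_eq_mul] at this

lemma mul_self_eq_one_of_coxeterForm_geomRep {w : W} {s : B} {a : ℝ}
    (h : coxeterForm M (geomRep cs w (simpleRoot s)) = a • coxeterForm M (simpleRoot s)) :
    a * a = 1 := by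
  simpa [coxeterForm_simpleRoot_self] using mul_mul_coxeterForm_eq h h

lemma IsCommutingFactorization.geomRep_mem_span (h : IsCommutingFactorization N K) {s : B}
    {n k : W} (hn : n ∈ N) (hk : k ∈ K)
    (hns : ¬ FormParallel M (simpleRoot s) (geomRep cs n (simpleRoot s))) :
    geomRep cs k (simpleRoot s) ∈
      Submodule.span ℝ {simpleRoot s, geomRep cs n (simpleRoot s)} := by
  obtain ⟨x, hx0, hx1⟩ := exists_coxeterForm_eq_zero_and_eq_one
    (x := geomRep cs k (simpleRoot s)) (y := geomRep cs (n * k) (simpleRoot s)) (by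
      rintro ⟨c, hc⟩
      refine hns ⟨c, ?_⟩
      have := coxeterForm_geomRep_congr cs hc k⁻¹
      rw [(h.1 n hn k hk).eq] at this
      simpa only [← geomRep_mul_apply, inv_mul_cancel_left, inv_mul_cancel, map_one,
        LinearEquiv.coe_one, id_eq] using this)
    (coxeterForm_geomRep_simpleRoot_self cs _ s)
  have hstar := h.coxeterForm_smul_add (cs := cs) s hn hk x
  rw [hx0, hx1, one_smul, zero_smul, add_zero] at hstar
  rw [eq_sub_of_add_eq' hstar]
  exact sub_mem (Submodule.smul_mem _ _ (Submodule.subset_span (by simp)))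
    (Submodule.smul_mem _ _ (Submodule.subset_span (by simp)))

lemma exists_forall_eq_or_eq [Finite B] {s : B} {x y : B →₀ ℝ}
    (h : Submodule.span ℝ {x, y} = ⊤) : ∃ t, ∀ u : B, u = s ∨ u = t := by
  classical
  have := Fintype.ofFinite B
  have hcard : Fintype.card B ≤ 2 := by
    have h1 := finrank_span_le_card (R := ℝ) ({x, y} : Set (B →₀ ℝ))
    rw [h, finrank_top, Module.finrank_finsupp_self] at h1
    refine h1.trans ?_
    simpa using Finset.card_le_two (a := x) (b := y)
  by_contra! hcon
  obtain ⟨t, hts, -⟩ := hcon s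
  obtain ⟨u, hus, hut⟩ := hcon t
  have h3 : ({s, t, u} : Finset B).card = 3 := by
    rw [Finset.card_eq_three]
    exact ⟨s, t, u, hts.symm, hus.symm, hut.symm, rfl⟩
  have := Finset.card_le_univ ({s, t, u} : Finset B)
  lia

lemma formParallel_of_forall_eq_or_eq {s t : B} (ht : ∀ u, u = s ∨ u = t) (hM : M s t = 0)
    (x : B →₀ ℝ) : FormParallel M x (simpleRoot s) := by
  have hform : coxeterForm M (simpleRoot t) = (-1 : ℝ) • coxeterForm M (simpleRoot s) := by
    refine linearMap_ext_simpleRoot fun u => ?_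
    obtain rfl | rfl := ht u
    · simp [coxeterForm_simpleRoot, M.symmetric t u, hM]
    · simp [coxeterForm_simpleRoot, hM]
  have htop : (Submodule.span ℝ {coxeterForm M (simpleRoot s)}).comap (coxeterForm M) = ⊤ := by
    refine eq_top_of_simpleRoot_mem fun u => ?_
    rw [Submodule.mem_comap]
    obtain rfl | rfl := ht u
    · exact Submodule.mem_span_singleton_self _
    · exact hform ▸ Submodule.smul_mem _ _ (Submodule.mem_span_singleton_self _)
  have hx : x ∈ (Submodule.span ℝ {coxeterForm M (simpleRoot s)}).comap (coxeterForm M) :=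
    htop ▸ Submodule.mem_top
  obtain ⟨c, hc⟩ := Submodule.mem_span_singleton.mp hx
  exact ⟨c, hc.symm⟩

lemma IsCommutingFactorization.formParallel_or_formParallel [Finite B] [Infinite W]
    (h : IsCommutingFactorization N K) (cs : CoxeterSystem M W)
    (hM : (coxeterGraph M).Preconnected) (s : B) :
    (∀ n ∈ N, FormParallel M (geomRep cs n (simpleRoot s)) (simpleRoot s)) ∨
      ∀ k ∈ K, FormParallel M (geomRep cs k (simpleRoot s)) (simpleRoot s) := by
  by_contra! hcon
  obtain ⟨⟨n, hn, hns⟩, k, hk, hks⟩ := hcon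
  have hns' : ¬ FormParallel M (simpleRoot s) (geomRep cs n (simpleRoot s)) :=
    fun hp => hns (hp.symm (coxeterForm_simpleRoot_self M s))
  have hks' : ¬ FormParallel M (simpleRoot s) (geomRep cs k (simpleRoot s)) :=
    fun hp => hks (hp.symm (coxeterForm_simpleRoot_self M s))
  set U := Submodule.span ℝ {simpleRoot s, geomRep cs n (simpleRoot s)} with hU
  have hsU : simpleRoot s ∈ U := Submodule.subset_span (by simp)
  have hKU (k' : W) (hk' : k' ∈ K) : geomRep cs k' (simpleRoot s) ∈ U :=
    h.geomRep_mem_span hn hk' hns'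
  have hNU (n' : W) (hn' : n' ∈ N) : geomRep cs n' (simpleRoot s) ∈ U := by
    refine Submodule.span_le.mpr ?_ (h.symm.geomRep_mem_span hk hn' hks')
    rintro x (rfl | rfl)
    · exact hsU
    · exact hKU k hk
  have htop : U = ⊤ := by
    refine eq_top_of_orbit_subset cs hM (s := s) fun w => ?_
    obtain ⟨n', hn', k', hk', rfl⟩ := h.2 w
    have hstar := h.coxeterForm_smul_add (cs := cs) s hn' hk'
      (geomRep cs (n' * k') (simpleRoot s))
    rw [coxeterForm_geomRep_simpleRoot_self, one_smul] at hstar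
    rw [← sub_eq_of_eq_add' hstar]
    exact sub_mem (add_mem (U.smul_mem _ (hNU n' hn')) (U.smul_mem _ (hKU k' hk')))
      (U.smul_mem _ hsU)
  obtain ⟨t, ht⟩ := exists_forall_eq_or_eq (s := s) htop
  by_cases h0 : M s t = 0
  · exact hns (formParallel_of_forall_eq_or_eq ht h0 _)
  · have := finite_of_forall_eq_or_eq cs ht h0
    exact not_finite W

lemma IsCommutingFactorization.formParallel_of_adj (h : IsCommutingFactorization N K) {s t : B}
    (hst : (coxeterGraph M).Adj s t)
    (hs : ∀ k ∈ K, FormParallel M (geomRep cs k (simpleRoot s)) (simpleRoot s))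
    (ht : ∀ n ∈ N, FormParallel M (geomRep cs n (simpleRoot t)) (simpleRoot t)) :
    ∀ k ∈ K, FormParallel M (geomRep cs k (simpleRoot t)) (simpleRoot t) := by
  set c := coxeterForm M (simpleRoot s) (simpleRoot t) with hcdef
  have hc0 : c ≠ 0 := coxeterForm_simpleRoot_ne_zero hst
  obtain ⟨n₀, hn₀, k₀, hk₀, hs₀⟩ := h.2 (cs.simple s)
  obtain ⟨n₁, hn₁, k₁, hk₁, ht₁⟩ := h.2 (cs.simple t)
  have hss : geomRep cs (cs.simple s) (simpleRoot s) = -simpleRoot s :=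
    geomRep_simple_simpleRoot cs s
  have hts : geomRep cs (cs.simple t) (simpleRoot s) = simpleRoot s - (2 * c) • simpleRoot t := by
    rw [geomRep_simple, coxeterForm_comm]
  have hst' : geomRep cs (cs.simple s) (simpleRoot t) = simpleRoot t - (2 * c) • simpleRoot s := by
    rw [geomRep_simple]
  obtain ⟨δ, hδ⟩ := hs k₁⁻¹ (inv_mem hk₁)
  have hδ0 : δ ≠ 0 := by
    rintro rfl
    simpa using mul_self_eq_one_of_coxeterForm_geomRep hδ
  obtain ⟨ε', hε'⟩ := ht n₀ hn₀
  obtain ⟨ε, hε⟩ : FormParallel M (geomRep cs n₀ (simpleRoot s)) (simpleRoot s) := by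
    obtain ⟨e, he⟩ := hs k₀⁻¹ (inv_mem hk₀)
    refine ⟨-e, ?_⟩
    have := coxeterForm_geomRep_congr cs he (cs.simple s)
    rw [← geomRep_mul_apply, hs₀, mul_inv_cancel_right, ← hs₀, hss] at this
    rw [this, map_neg, smul_neg]
    module
  have hεε : ε * ε = 1 := mul_self_eq_one_of_coxeterForm_geomRep hε
  have hεε' : ε * ε' = 1 := by
    have := mul_mul_coxeterForm_eq hε hε'
    rw [← mul_assoc] at this
    exact mul_right_cancel₀ hc0 (this.trans (one_mul c).symm)
  have hw : cs.simple s * cs.simple t * k₁⁻¹ =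
      n₀ * cs.simple t * n₀⁻¹ * k₁⁻¹ * cs.simple s := by
    have a1 : k₁ * n₀⁻¹ = n₀⁻¹ * k₁ := (h.1 _ (inv_mem hn₀) k₁ hk₁).symm
    have a2 : n₁ * k₀ = k₀ * n₁ := h.1 n₁ hn₁ k₀ hk₀
    calc cs.simple s * cs.simple t * k₁⁻¹ = n₀ * (k₀ * n₁) := by rw [hs₀, ht₁]; group
      _ = n₀ * n₁ * (n₀⁻¹ * k₁) * k₁⁻¹ * n₀ * k₀ := by rw [← a2]; group
      _ = _ := by rw [← a1, hs₀, ht₁]; group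
  have hL : coxeterForm M (geomRep cs (cs.simple s * cs.simple t * k₁⁻¹) (simpleRoot s)) =
      δ • coxeterForm M (geomRep cs (cs.simple s * cs.simple t) (simpleRoot s)) := by
    rw [geomRep_mul_apply]
    exact coxeterForm_geomRep_congr cs hδ _
  have hR : coxeterForm M (geomRep cs (n₀ * cs.simple t * n₀⁻¹ * k₁⁻¹ * cs.simple s)
      (simpleRoot s)) = -δ • coxeterForm M (geomRep cs (cs.simple t) (simpleRoot s)) := by
    have hinv : coxeterForm M (geomRep cs n₀⁻¹ (simpleRoot s)) =
        ε • coxeterForm M (simpleRoot s) := by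
      have := coxeterForm_geomRep_congr cs hε n₀⁻¹
      rw [geomRep_inv_apply_self] at this
      rw [this, smul_smul, hεε, one_smul]
    have h1 := coxeterForm_geomRep_congr cs hδ (n₀ * cs.simple t * n₀⁻¹)
    have h2 := coxeterForm_geomRep_congr cs hinv (n₀ * cs.simple t)
    rw [geomRep_mul_apply, hss, map_neg, map_neg, geomRep_mul_apply, h1,
      geomRep_mul_apply _ _ n₀⁻¹, h2, geomRep_mul_apply, hts]
    simp only [map_sub, map_smul, hε, hε']
    linear_combination (norm := module) (-δ) • hεε • coxeterForm M (simpleRoot s) +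
      (2 * c * δ) • hεε' • coxeterForm M (simpleRoot t)
  have hpar : coxeterForm M (simpleRoot t) = c • coxeterForm M (simpleRoot s) := by
    rw [hw, hR, geomRep_mul_apply, hts] at hL
    simp only [map_sub, map_smul, hss, hst', map_neg] at hL
    refine smul_right_injective _ (mul_ne_zero (mul_ne_zero (four_ne_zero (α := ℝ)) hδ0) hc0) ?_
    linear_combination (norm := module) hL
  intro k hk
  obtain ⟨e, he⟩ := hs k hk
  refine ⟨e, ?_⟩
  rw [coxeterForm_geomRep_congr cs hpar, he, smul_comm, ← hpar]

lemma IsCommutingFactorization.exists_forall_coxeterForm_eq [Finite B] [Infinite W]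
    (h : IsCommutingFactorization N K) (cs : CoxeterSystem M W)
    (hM : (coxeterGraph M).Preconnected) {s : B}
    (hs : ∀ k ∈ K, FormParallel M (geomRep cs k (simpleRoot s)) (simpleRoot s)) {k : W}
    (hk : k ∈ K) :
    ∃ ε : ℝ, ∀ x, coxeterForm M (geomRep cs k x) = ε • coxeterForm M x := by
  have hall (t : B) : ∀ k ∈ K, FormParallel M (geomRep cs k (simpleRoot t)) (simpleRoot t) := by
    refine forall_of_preconnected hM (p := fun t => ∀ k ∈ K,
      FormParallel M (geomRep cs k (simpleRoot t)) (simpleRoot t)) hs (fun t u htu ht => ?_) t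
    exact (h.formParallel_or_formParallel cs hM u).elim (h.formParallel_of_adj htu ht) id
  obtain ⟨ε, hε⟩ := hs k hk
  refine ⟨ε, fun x => ?_⟩
  suffices (coxeterForm M) ∘ₗ (geomRep cs k).toLinearMap = ε • coxeterForm M from
    LinearMap.congr_fun this x
  refine linearMap_ext_simpleRoot fun t => ?_
  refine forall_of_preconnected hM (p := fun t =>
    coxeterForm M (geomRep cs k (simpleRoot t)) = ε • coxeterForm M (simpleRoot t)) hε
    (fun t u htu ht => ?_) t
  obtain ⟨e, he⟩ := hall u k hk
  have hc := coxeterForm_simpleRoot_ne_zero htu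
  have h1 := mul_mul_coxeterForm_eq ht he
  have h2 : ε * e = 1 := by
    rw [← mul_assoc] at h1
    exact mul_right_cancel₀ hc (h1.trans (one_mul _).symm)
  have h3 : e = ε := by
    linear_combination ε * h2 - e * mul_self_eq_one_of_coxeterForm_geomRep hε
  rw [he, h3]

/-- A nontrivial `k ∈ K` acting trivially modulo the radical forces `N = ⊥`. -/
lemma IsCommutingFactorization.eq_bot_of_coxeterForm_eq [Finite B] [Infinite W]
    (h : IsCommutingFactorization N K) (cs : CoxeterSystem M W)
    (hM : (coxeterGraph M).Preconnected)
    (hK : ∀ k ∈ K, ∃ ε : ℝ, ∀ x, coxeterForm M (geomRep cs k x) = ε • coxeterForm M x)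
    {k : W} (hk : k ∈ K) (hk1 : k ≠ 1)
    (hkx : ∀ x, coxeterForm M (geomRep cs k x) = coxeterForm M x) : N = ⊥ := by
  let f : (B →₀ ℝ) →ₗ[ℝ] (B →₀ ℝ) := (geomRep cs k).toLinearMap - LinearMap.id
  have hf (x : B →₀ ℝ) : f x = geomRep cs k x - x := rfl
  have hfrad (x : B →₀ ℝ) : coxeterForm M (f x) = 0 := by
    rw [hf, map_sub, hkx, sub_self]
  have hf0 {x : B →₀ ℝ} (hx : coxeterForm M x = 0) : f x = 0 := by
    rw [hf, geomRep_of_coxeterForm_eq_zero cs hx, sub_self]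
  have hfn {n : W} (hn : n ∈ N) (x : B →₀ ℝ) : f (geomRep cs n x) = f x := by
    rw [hf, ← geomRep_mul_apply, ← (h.1 n hn k hk).eq, geomRep_mul_apply, ← map_sub, ← hf,
      geomRep_of_coxeterForm_eq_zero cs (hfrad x)]
  have hfw (w : W) : ∃ ε : ℝ, ∀ x, f (geomRep cs w x) = ε • f x := by
    obtain ⟨n, hn, k', hk', rfl⟩ := h.2 w
    obtain ⟨ε, hε⟩ := hK k' hk'
    refine ⟨ε, fun x => ?_⟩
    rw [geomRep_mul_apply, hfn hn, ← map_smul, ← sub_eq_zero, ← map_sub]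
    exact hf0 (by rw [map_sub, hε, map_smul, sub_self])
  obtain ⟨s, hs⟩ : ∃ s, f (simpleRoot s) ≠ 0 := by
    by_contra! hcon
    have hf_zero : f = 0 := linearMap_ext_simpleRoot fun s => by simp [hcon s]
    refine hk1 ((geomRep_eq_one_iff cs).mp fun x => ?_)
    rw [← sub_eq_zero, ← hf, hf_zero, LinearMap.zero_apply]
  have hft {t : B} (ht : f (simpleRoot t) ≠ 0) (x : B →₀ ℝ) :
      f x = coxeterForm M (simpleRoot t) x • f (simpleRoot t) := by
    obtain ⟨ε, hε⟩ := hfw (cs.simple t)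
    have h1 := hε (simpleRoot t)
    rw [geomRep_simple_simpleRoot, map_neg] at h1
    have h2 : ε = -1 := smul_left_injective ℝ ht (by simp [← h1])
    have h3 := hε x
    rw [geomRep_simple, map_sub, map_smul, h2] at h3
    refine smul_right_injective _ (two_ne_zero (α := ℝ)) ?_
    linear_combination (norm := module) h3
  have hne (t : B) : f (simpleRoot t) ≠ 0 := by
    refine forall_of_preconnected hM (p := fun t => f (simpleRoot t) ≠ 0) hs
      (fun t u htu ht => ?_) t
    rw [hft ht]
    exact smul_ne_zero (coxeterForm_simpleRoot_ne_zero htu) ht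
  have hker {x : B →₀ ℝ} (hx : f x = 0) : coxeterForm M x = 0 := by
    refine linearMap_ext_simpleRoot fun t => ?_
    rw [coxeterForm_comm, LinearMap.zero_apply]
    exact (smul_eq_zero.mp ((hft (hne t) x).symm.trans hx)).resolve_right (hne t)
  have hsimple (t : B) : cs.simple t ∈ K := by
    obtain ⟨n, hn, k', hk', ht⟩ := h.2 (cs.simple t)
    suffices n = 1 by rwa [ht, this, one_mul]
    let g : (B →₀ ℝ) →ₗ[ℝ] (B →₀ ℝ) := (geomRep cs n).toLinearMap - LinearMap.id
    have hg (x : B →₀ ℝ) : g x = geomRep cs n x - x := rfl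
    have hgrad (x : B →₀ ℝ) : coxeterForm M (g x) = 0 :=
      hker (by rw [hg, map_sub, hfn hn, sub_self])
    have hg0 {x : B →₀ ℝ} (hx : coxeterForm M x = 0) : g x = 0 := by
      rw [hg, geomRep_of_coxeterForm_eq_zero cs hx, sub_self]
    have hcomm : Commute n (cs.simple t) := ht ▸ (Commute.refl n).mul_right (h.1 n hn k' hk')
    have hgt : g (simpleRoot t) = 0 := by
      have h1 : g (geomRep cs (cs.simple t) (simpleRoot t)) = g (simpleRoot t) := by
        rw [hg, ← geomRep_mul_apply, hcomm.eq, geomRep_mul_apply, ← map_sub, ← hg,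
          geomRep_of_coxeterForm_eq_zero cs (hgrad _)]
      rw [geomRep_simple_simpleRoot, map_neg] at h1
      exact self_eq_neg.mp h1.symm
    refine (geomRep_eq_one_iff cs).mp fun x => ?_
    rw [← sub_eq_zero, ← hg]
    have h1 : g (x - coxeterForm M (simpleRoot t) x • simpleRoot t) = 0 := by
      refine hg0 (hker ?_)
      rw [map_sub, map_smul, ← hft (hne t), sub_self]
    rwa [map_sub, map_smul, hgt, smul_zero, sub_zero] at h1
  have hKtop : K = ⊤ := by
    rw [eq_top_iff, ← cs.subgroup_closure_range_simple, Subgroup.closure_le]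
    rintro _ ⟨t, rfl⟩
    exact hsimple t
  exact (Subgroup.eq_bot_iff_forall _).mpr fun n hn =>
    eq_one_of_forall_commute cs hM fun w => h.1 n hn w (hKtop ▸ Subgroup.mem_top w)

lemma IsCommutingFactorization.eq_bot_or_eq_bot_of_formParallel [Finite B] [Infinite W]
    (h : IsCommutingFactorization N K) (cs : CoxeterSystem M W)
    (hM : (coxeterGraph M).Preconnected) {s : B}
    (hs : ∀ k ∈ K, FormParallel M (geomRep cs k (simpleRoot s)) (simpleRoot s)) :
    N = ⊥ ∨ K = ⊥ := by
  have hK (k : W) (hk : k ∈ K) := h.exists_forall_coxeterForm_eq cs hM hs hk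
  by_cases hcase : ∃ k ∈ K, k ≠ 1 ∧ ∀ x, coxeterForm M (geomRep cs k x) = coxeterForm M x
  · obtain ⟨k, hk, hk1, hkx⟩ := hcase
    exact .inl (h.eq_bot_of_coxeterForm_eq cs hM hK hk hk1 hkx)
  · push Not at hcase
    refine .inr ((Subgroup.eq_bot_iff_forall _).mpr fun k hk =>
      eq_one_of_forall_commute cs hM fun w => ?_)
    obtain ⟨n, hn, k', hk', rfl⟩ := h.2 w
    refine (h.1 n hn k hk).symm.mul_right ?_
    by_contra hne
    obtain ⟨x, hx⟩ := hcase (k * k' * (k' * k)⁻¹)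
      (mul_mem (mul_mem hk hk') (inv_mem (mul_mem hk' hk)))
      (fun h1 => hne (mul_inv_eq_one.mp h1))
    obtain ⟨ε, hε⟩ := hK k hk
    obtain ⟨ε', hε'⟩ := hK k' hk'
    refine hx ?_
    have h1 : geomRep cs (k' * k) (geomRep cs (k' * k)⁻¹ x) = x := by
      rw [← geomRep_mul_apply]
      simp
    rw [geomRep_mul_apply, geomRep_mul_apply cs k, hε, hε', smul_comm, ← hε, ← hε',
      ← geomRep_mul_apply, h1]

/-- An infinite irreducible Coxeter group has no nontrivial factorization into commuting
subgroups. -/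
theorem IsCommutingFactorization.eq_bot_or_eq_bot [Finite B] [Infinite W]
    (h : IsCommutingFactorization N K) (cs : CoxeterSystem M W)
    (hM : (coxeterGraph M).Preconnected) : N = ⊥ ∨ K = ⊥ := by
  obtain hB | ⟨⟨s⟩⟩ := isEmpty_or_nonempty B
  · refine .inl ((Subgroup.eq_bot_iff_forall _).mpr fun w _ =>
      (geomRep_eq_one_iff cs).mp fun x => ?_)
    exact Subsingleton.elim _ _
  obtain hs | hs := h.formParallel_or_formParallel cs hM s
  · exact (h.symm.eq_bot_or_eq_bot_of_formParallel cs hM hs).symm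
  · exact h.eq_bot_or_eq_bot_of_formParallel cs hM hs

end Indecomposable

section DirectProduct

/-- A nontrivial group without nontrivial finite normal subgroups and without nontrivial
factorizations into commuting subgroups. -/
structure IsStronglyIndecomposable (G : Type*) [Group G] : Prop where
  nontrivial : Nontrivial G
  eq_bot_of_finite_normal (N : Subgroup G) : N.Normal → Finite N → N = ⊥
  eq_bot_or_eq_bot {N K : Subgroup G} : IsCommutingFactorization N K → N = ⊥ ∨ K = ⊥

lemma pi_eq_bot_of_finite_normal {ι : Type*} {A : ι → Type*} [∀ i, Group (A i)]
    (hA : ∀ i, IsStronglyIndecomposable (A i)) (N : Subgroup (∀ i, A i)) (hN : N.Normal)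
    (hfin : Finite N) : N = ⊥ := by
  refine (Subgroup.eq_bot_iff_forall _).mpr fun x hx => funext fun i => ?_
  have hbot : N.map (Pi.evalMonoidHom A i) = ⊥ := by
    refine (hA i).eq_bot_of_finite_normal _ (hN.map _ (Function.surjective_eval i)) ?_
    exact (Set.toFinite (N : Set (∀ i, A i))).image (Pi.evalMonoidHom A i)
  have : Pi.evalMonoidHom A i x ∈ N.map (Pi.evalMonoidHom A i) := Subgroup.mem_map_of_mem _ hx
  rwa [hbot, Subgroup.mem_bot] at this

lemma fst_apply_one_prod {A F A' F' : Type*} [Group A] [Group F] [Group A'] [Group F'] [Finite F]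
    (hA' : ∀ N : Subgroup A', N.Normal → Finite N → N = ⊥) (e : A × F ≃* A' × F') (f : F) :
    (e (1, f)).1 = 1 := by
  let φ : A × F →* A' := (MonoidHom.fst A' F').comp e.toMonoidHom
  have hφ : Function.Surjective φ := Prod.fst_surjective.comp e.surjective
  have hN : ((⊥ : Subgroup A).prod (⊤ : Subgroup F)).Normal := Subgroup.prod_normal _ _
  have hfin : (((⊥ : Subgroup A).prod (⊤ : Subgroup F) : Subgroup (A × F)) : Set (A × F)).Finite :=
    ((Set.finite_singleton 1).prod (Set.toFinite _)).subset fun x hx => hx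
  have hbot := hA' _ (hN.map φ hφ) (hfin.image φ)
  have : φ (1, f) ∈ ((⊥ : Subgroup A).prod (⊤ : Subgroup F)).map φ :=
    Subgroup.mem_map_of_mem _ (by simp [Subgroup.mem_prod])
  rwa [hbot, Subgroup.mem_bot] at this

/-- An isomorphism of products of groups without finite normal subgroups by finite groups
induces isomorphisms of both factors. -/
theorem nonempty_mulEquiv_of_prod {A F A' F' : Type*} [Group A] [Group F] [Group A'] [Group F']
    [Finite F] [Finite F'] (hA : ∀ N : Subgroup A, N.Normal → Finite N → N = ⊥)
    (hA' : ∀ N : Subgroup A', N.Normal → Finite N → N = ⊥) (e : A × F ≃* A' × F') :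
    Nonempty (F ≃* F') ∧ Nonempty (A ≃* A') := by
  have h (f : F) : e (1, f) = (1, (e (1, f)).2) := Prod.ext (fst_apply_one_prod hA' e f) rfl
  have h' (f : F') : e.symm (1, f) = (1, (e.symm (1, f)).2) :=
    Prod.ext (fst_apply_one_prod hA e.symm f) rfl
  refine ⟨⟨MonoidHom.toMulEquiv
    ((MonoidHom.snd A' F').comp (e.toMonoidHom.comp (MonoidHom.inr A F)))
    ((MonoidHom.snd A F).comp (e.symm.toMonoidHom.comp (MonoidHom.inr A' F'))) ?_ ?_⟩,
    ⟨MonoidHom.toMulEquiv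
    ((MonoidHom.fst A' F').comp (e.toMonoidHom.comp (MonoidHom.inl A F)))
    ((MonoidHom.fst A F).comp (e.symm.toMonoidHom.comp (MonoidHom.inl A' F'))) ?_ ?_⟩⟩
  · ext f
    change (e.symm (1, (e (1, f)).2)).2 = f
    rw [← h, e.symm_apply_apply]
  · ext f
    change (e (1, (e.symm (1, f)).2)).2 = f
    rw [← h', e.apply_symm_apply]
  · ext a
    change (e.symm ((e (a, 1)).1, 1)).1 = a
    have : ((e (a, 1)).1, (1 : F')) = e (a, 1) * (1, (e (a, 1)).2⁻¹) := by ext <;> simp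
    rw [this, map_mul, e.symm_apply_apply, h']
    simp
  · ext a
    change (e ((e.symm (a, 1)).1, 1)).1 = a
    have : ((e.symm (a, 1)).1, (1 : F)) = e.symm (a, 1) * (1, (e.symm (a, 1)).2⁻¹) := by
      ext <;> simp
    rw [this, map_mul, e.apply_symm_apply, h]
    simp

section Pi

variable {ι κ : Type*} [DecidableEq ι] [DecidableEq κ] {A : ι → Type*} {A' : κ → Type*}
  [∀ i, Group (A i)] [∀ j, Group (A' j)]

/-- The factor `A i` has nontrivial component in the factor `A' j`. -/
def Meets (θ : (∀ i, A i) ≃* (∀ j, A' j)) (i : ι) (j : κ) : Prop :=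
  ∃ x : A i, θ (Pi.mulSingle i x) j ≠ 1

variable {θ : (∀ i, A i) ≃* (∀ j, A' j)}

lemma Meets.apply_eq_one (hA' : ∀ j, IsStronglyIndecomposable (A' j)) {i : ι} {j : κ}
    (h : Meets θ i j) {x : ∀ i, A i} (hx : x i = 1) : θ x j = 1 := by
  let φ : (∀ i, A i) →* A' j := (Pi.evalMonoidHom A' j).comp θ.toMonoidHom
  have hfac : IsCommutingFactorization (φ.comp (MonoidHom.mulSingle A i)).range
      ((Pi.evalMonoidHom A i).ker.map φ) := by
    constructor
    · rintro _ ⟨y, rfl⟩ _ ⟨z, hz, rfl⟩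
      refine Commute.map (f := φ) (funext fun l => ?_)
      obtain rfl | hl := eq_or_ne l i
      · have : z l = 1 := hz
        simp [this]
      · simp [hl]
    · intro g
      set y := θ.symm (Pi.mulSingle j g) with hy
      refine ⟨_, ⟨y i, rfl⟩, _, ⟨(Pi.mulSingle i (y i))⁻¹ * y, ?_, rfl⟩, ?_⟩
      · simp
      · rw [MonoidHom.comp_apply, MonoidHom.mulSingle_apply, ← map_mul, mul_inv_cancel_left]
        simp [φ, hy]
  obtain h1 | h1 := (hA' j).eq_bot_or_eq_bot hfac
  · obtain ⟨y, hy⟩ := h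
    have hmem : φ (Pi.mulSingle i y) ∈ (φ.comp (MonoidHom.mulSingle A i)).range := ⟨y, rfl⟩
    rw [h1, Subgroup.mem_bot] at hmem
    exact absurd hmem hy
  · have hmem : φ x ∈ (Pi.evalMonoidHom A i).ker.map φ := Subgroup.mem_map_of_mem _ hx
    rwa [h1, Subgroup.mem_bot] at hmem

lemma Meets.symm (hA' : ∀ j, IsStronglyIndecomposable (A' j)) {i : ι} {j : κ}
    (h : Meets θ i j) : Meets θ.symm j i := by
  by_contra hcon
  simp only [Meets, not_exists, not_not] at hcon
  obtain ⟨x, hx⟩ := h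
  have := Meets.apply_eq_one hA' ⟨x, hx⟩ (hcon (θ (Pi.mulSingle i x) j))
  rw [θ.apply_symm_apply, Pi.mulSingle_eq_same] at this
  exact hx this

lemma Meets.unique_left (hA' : ∀ j, IsStronglyIndecomposable (A' j)) {i l : ι} {j : κ}
    (h : Meets θ i j) (hl : Meets θ l j) : i = l := by
  by_contra hne
  obtain ⟨x, hx⟩ := hl
  exact hx (h.apply_eq_one hA' (Pi.mulSingle_eq_of_ne hne x))

lemma exists_meets [Finite ι] (hA' : ∀ j, IsStronglyIndecomposable (A' j)) (j : κ) :
    ∃ i, Meets θ i j := by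
  by_contra! hcon
  simp only [Meets, not_exists, not_not] at hcon
  have := (hA' j).nontrivial
  obtain ⟨y, hy⟩ := exists_ne (1 : A' j)
  refine hy ?_
  have hmem : θ.symm (Pi.mulSingle j y) ∈
      ((Pi.evalMonoidHom A' j).comp θ.toMonoidHom).ker :=
    Subgroup.pi_mem_of_mulSingle_mem _ fun i => hcon i _
  rw [MonoidHom.mem_ker] at hmem
  simpa using hmem

lemma Meets.symm_apply_apply (hA : ∀ i, IsStronglyIndecomposable (A i)) {i : ι} {j : κ}
    (h : Meets θ.symm j i) (x : A i) :
    θ.symm (Pi.mulSingle j (θ (Pi.mulSingle i x) j)) i = x := by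
  have := h.apply_eq_one hA (x := θ (Pi.mulSingle i x) *
    (Pi.mulSingle j (θ (Pi.mulSingle i x) j))⁻¹) (by simp)
  rw [map_mul, θ.symm_apply_apply, map_inv, Pi.mul_apply, Pi.mulSingle_eq_same, Pi.inv_apply,
    mul_inv_eq_one] at this
  exact this.symm

/-- Krull-Remak-Schmidt type uniqueness for finite products of strongly indecomposable groups. -/
theorem exists_equiv_of_pi_mulEquiv [Finite ι] [Finite κ]
    (hA : ∀ i, IsStronglyIndecomposable (A i)) (hA' : ∀ j, IsStronglyIndecomposable (A' j))
    (θ : (∀ i, A i) ≃* (∀ j, A' j)) : ∃ σ : ι ≃ κ, ∀ i, Nonempty (A i ≃* A' (σ i)) := by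
  choose g hg using exists_meets (θ := θ) hA'
  choose f hf using exists_meets (θ := θ.symm) hA
  have hf' (i : ι) : Meets θ i (f i) := (hf i).symm hA
  refine ⟨⟨f, g, fun i => (hg (f i)).unique_left hA' (hf' i),
    fun j => (hf (g j)).unique_left hA ((hg j).symm hA')⟩, fun i => ⟨MonoidHom.toMulEquiv
      ((Pi.evalMonoidHom A' (f i)).comp (θ.toMonoidHom.comp (MonoidHom.mulSingle A i)))
      ((Pi.evalMonoidHom A i).comp (θ.symm.toMonoidHom.comp (MonoidHom.mulSingle A' (f i))))
      ?_ ?_⟩⟩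
  · ext x
    exact (hf i).symm_apply_apply hA x
  · ext x
    exact Meets.symm_apply_apply (θ := θ.symm) hA' (hf' i) x

end Pi

end DirectProduct

section Components

/-- The restriction of a Coxeter matrix to a subset of its index set. -/
def restrictMatrix (M : CoxeterMatrix B) (X : Set B) : CoxeterMatrix X where
  M := M.M.submatrix (↑) (↑)
  isSymm := M.isSymm.submatrix _
  diagonal s := M.diagonal s
  off_diagonal s t h := M.off_diagonal s t (Subtype.coe_ne_coe.mpr h)

/-- `X` is a union of connected components of the Coxeter graph. -/
def IsComponentUnion (M : CoxeterMatrix B) (X : Set B) : Prop :=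
  ∀ s ∈ X, ∀ t ∉ X, M s t = 2

variable {M : CoxeterMatrix B}

lemma coxeterGraph_adj {s t : B} : (coxeterGraph M).Adj s t ↔
    s ≠ t ∧ ((M s t = 0 ∨ 3 ≤ M s t) ∨ M t s = 0 ∨ 3 ≤ M t s) :=
  SimpleGraph.fromRel_adj _ s t

lemma eq_two_of_connectedComponentMk_ne {s t : B}
    (h : (coxeterGraph M).connectedComponentMk s ≠ (coxeterGraph M).connectedComponentMk t) :
    M s t = 2 := by
  have hst : s ≠ t := by
    rintro rfl
    exact h rfl
  have hadj : ¬ (coxeterGraph M).Adj s t := fun hadj =>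
    h (SimpleGraph.ConnectedComponent.sound hadj.reachable)
  rw [coxeterGraph_adj] at hadj
  have := M.off_diagonal s t hst
  grind

lemma isComponentUnion_supp (c : (coxeterGraph M).ConnectedComponent) :
    IsComponentUnion M c.supp := by
  intro s hs t ht
  refine eq_two_of_connectedComponentMk_ne fun h => ht ?_
  rw [SimpleGraph.ConnectedComponent.mem_supp_iff] at hs ⊢
  rw [← h, hs]

lemma coxeterGraph_restrictMatrix_supp_preconnected (c : (coxeterGraph M).ConnectedComponent) :
    (coxeterGraph (restrictMatrix M c.supp)).Preconnected := by
  have : coxeterGraph (restrictMatrix M c.supp) = c.toSimpleGraph := by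
    ext s t
    change _ ↔ (coxeterGraph M).Adj (s : B) (t : B)
    exact coxeterGraph_adj.trans
      ((and_congr (not_congr Subtype.ext_iff) Iff.rfl).trans coxeterGraph_adj.symm)
  rw [this]
  exact c.connected_toSimpleGraph.preconnected

section Lift

variable (cs : CoxeterSystem M W) {X : Set B} {G : Type*} [Group G]

open Classical in
/-- The extension by `1` of a homomorphism defined on the generators in `X`. -/
def parabolicLift (hX : IsComponentUnion M X) (f : X → G)
    (hf : (restrictMatrix M X).IsLiftable f) : W →* G :=
  cs.lift ⟨fun s => if h : s ∈ X then f ⟨s, h⟩ else 1, fun s t => by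
    have hsq (u : X) : f u ^ 2 = 1 := by
      have := hf u u
      rwa [CoxeterMatrix.diagonal, pow_one, ← pow_two] at this
    by_cases hs : s ∈ X <;> by_cases ht : t ∈ X
    · simp only [hs, ht, dif_pos]
      exact hf ⟨s, hs⟩ ⟨t, ht⟩
    · simp [hs, ht, hX s hs t ht, hsq]
    · simp [hs, ht, M.symmetric s t, hX t ht s hs, hsq]
    · simp [hs, ht]⟩

lemma parabolicLift_simple (hX : IsComponentUnion M X) (f : X → G)
    (hf : (restrictMatrix M X).IsLiftable f) (s : X) :
    parabolicLift cs hX f hf (cs.simple s) = f s :=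
  (cs.lift_apply_simple _ _).trans (dif_pos s.2)

lemma parabolicLift_simple_of_notMem (hX : IsComponentUnion M X) (f : X → G)
    (hf : (restrictMatrix M X).IsLiftable f) {s : B} (hs : s ∉ X) :
    parabolicLift cs hX f hf (cs.simple s) = 1 :=
  (cs.lift_apply_simple _ _).trans (dif_neg hs)

/-- The generator of a standard parabolic subgroup indexed by `s`. -/
def parabolicSimple (X : Set B) (s : X) : standardParabolic cs X :=
  ⟨cs.simple s, Subgroup.subset_closure ⟨s, s.2, rfl⟩⟩

lemma isLiftable_parabolicSimple : (restrictMatrix M X).IsLiftable (parabolicSimple cs X) :=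
  fun s t => Subtype.ext (cs.simple_mul_simple_pow s t)

variable {cs} in
lemma standardParabolic_hom_ext {f g : standardParabolic cs X →* G}
    (h : ∀ s, f (parabolicSimple cs X s) = g (parabolicSimple cs X s)) : f = g := by
  ext ⟨x, hx⟩
  induction hx using Subgroup.closure_induction with
  | mem x hx =>
    obtain ⟨s, hs, rfl⟩ := hx
    exact h ⟨s, hs⟩
  | one => exact (map_one f).trans (map_one g).symm
  | mul x y hx hy ihx ihy =>
    exact (map_mul f ⟨x, hx⟩ ⟨y, hy⟩).trans
      ((congrArg₂ (· * ·) ihx ihy).trans (map_mul g ⟨x, hx⟩ ⟨y, hy⟩).symm)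
  | inv x hx ih =>
    exact (map_inv f ⟨x, hx⟩).trans ((congrArg (·⁻¹) ih).trans (map_inv g ⟨x, hx⟩).symm)

/-- The standard parabolic subgroup of a union of components is a Coxeter group. -/
def parabolicCoxeterSystem (hX : IsComponentUnion M X) :
    CoxeterSystem (restrictMatrix M X) (standardParabolic cs X) :=
  (restrictMatrix M X).toCoxeterSystem.map (MonoidHom.toMulEquiv
    ((restrictMatrix M X).toCoxeterSystem.lift
      ⟨parabolicSimple cs X, isLiftable_parabolicSimple cs⟩)
    ((parabolicLift cs hX (restrictMatrix M X).toCoxeterSystem.simple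
      (restrictMatrix M X).toCoxeterSystem.simple_mul_simple_pow).comp (Subgroup.subtype _))
    (by
      refine CoxeterSystem.ext_simple (restrictMatrix M X).toCoxeterSystem fun s => ?_
      rw [MonoidHom.comp_apply, CoxeterSystem.lift_apply_simple]
      exact parabolicLift_simple cs hX _
        (restrictMatrix M X).toCoxeterSystem.simple_mul_simple_pow s)
    (by
      refine standardParabolic_hom_ext fun s => ?_
      have := parabolicLift_simple cs hX (restrictMatrix M X).toCoxeterSystem.simple
        (restrictMatrix M X).toCoxeterSystem.simple_mul_simple_pow s
      rw [MonoidHom.comp_apply, MonoidHom.comp_apply]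
      refine (congrArg _ this).trans ?_
      rw [CoxeterSystem.lift_apply_simple]
      rfl))

/-- The retraction onto the standard parabolic subgroup of a union of components. -/
def parabolicProj (hX : IsComponentUnion M X) : W →* standardParabolic cs X :=
  parabolicLift cs hX (parabolicSimple cs X) (isLiftable_parabolicSimple cs)

lemma parabolicProj_coe (hX : IsComponentUnion M X) (x : standardParabolic cs X) :
    parabolicProj cs hX x = x := by
  have : (parabolicProj cs hX).comp (Subgroup.subtype _) = MonoidHom.id _ :=
    standardParabolic_hom_ext fun s =>
      parabolicLift_simple cs hX _ (isLiftable_parabolicSimple cs) s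
  exact DFunLike.congr_fun this x

lemma parabolicProj_eq_one (hX : IsComponentUnion M X) {Y : Set B} (hXY : Disjoint X Y)
    (y : standardParabolic cs Y) : parabolicProj cs hX y = 1 := by
  have : (parabolicProj cs hX).comp (Subgroup.subtype (standardParabolic cs Y)) = 1 :=
    standardParabolic_hom_ext fun s =>
      parabolicLift_simple_of_notMem cs hX _ (isLiftable_parabolicSimple cs)
        (hXY.notMem_of_mem_right s.2)
  exact DFunLike.congr_fun this y

lemma commute_of_mem_standardParabolic (hX : IsComponentUnion M X) {Y : Set B}
    (hXY : Disjoint X Y) {x y : W} (hx : x ∈ standardParabolic cs X)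
    (hy : y ∈ standardParabolic cs Y) : Commute x y := by
  have key : standardParabolic cs X ≤ Subgroup.centralizer (standardParabolic cs Y) := by
    rw [standardParabolic, Subgroup.closure_le]
    rintro _ ⟨s, hs, rfl⟩
    suffices standardParabolic cs Y ≤ Subgroup.centralizer {cs.simple s} from
      Subgroup.mem_centralizer_iff.mpr fun y hy =>
        (Subgroup.mem_centralizer_iff.mp (this hy) _ rfl).symm
    rw [standardParabolic, Subgroup.closure_le]
    rintro _ ⟨t, ht, rfl⟩
    refine Subgroup.mem_centralizer_iff.mpr ?_
    rintro _ rfl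
    have h := cs.simple_mul_simple_pow s t
    rw [hX s hs t (hXY.notMem_of_mem_right ht), pow_two, mul_eq_one_iff_eq_inv] at h
    simpa using h
  exact (Subgroup.mem_centralizer_iff.mp (key hx) y hy).symm

end Lift

theorem isStronglyIndecomposable_standardParabolic [Finite B] (cs : CoxeterSystem M W)
    (c : (coxeterGraph M).ConnectedComponent) [Infinite (standardParabolic cs c.supp)] :
    IsStronglyIndecomposable (standardParabolic cs c.supp) where
  nontrivial := inferInstance
  eq_bot_of_finite_normal N _ _ := CoxeterPaper.eq_bot_of_finite_normal
    (parabolicCoxeterSystem cs (isComponentUnion_supp c))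
    (coxeterGraph_restrictMatrix_supp_preconnected c) N
  eq_bot_or_eq_bot h := h.eq_bot_or_eq_bot
    (parabolicCoxeterSystem cs (isComponentUnion_supp c))
    (coxeterGraph_restrictMatrix_supp_preconnected c)

/-- A partition of the generators into unions of components decomposes the Coxeter group as a
direct product. -/
theorem bijective_pi_parabolicProj {ι : Type*} [Finite ι] (cs : CoxeterSystem M W)
    {P : ι → Set B} (hP : ∀ i, IsComponentUnion M (P i))
    (hdisj : Pairwise fun i j => Disjoint (P i) (P j)) (hcover : ∀ s, ∃ i, s ∈ P i) :
    Function.Bijective (MonoidHom.pi fun i => parabolicProj cs (hP i)) := by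
  classical
  have := Fintype.ofFinite ι
  have hsingle (i : ι) (x : standardParabolic cs (P i)) :
      (MonoidHom.pi fun i => parabolicProj cs (hP i)) x = Pi.mulSingle i x := by
    ext1 j
    obtain rfl | hij := eq_or_ne j i
    · rw [Pi.mulSingle_eq_same]
      exact parabolicProj_coe cs (hP j) x
    · rw [Pi.mulSingle_eq_of_ne hij]
      exact parabolicProj_eq_one cs (hP j) (hdisj hij) x
  constructor
  · let Ψ : (∀ i, standardParabolic cs (P i)) →* W := Subgroup.noncommPiCoprod
      (fun i j hij x y hx hy => commute_of_mem_standardParabolic cs (hP i) (hdisj hij) hx hy)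
    have hΨ : Ψ.comp (MonoidHom.pi fun i => parabolicProj cs (hP i)) = MonoidHom.id W := by
      refine cs.ext_simple fun s => ?_
      obtain ⟨i, hi⟩ := hcover s
      have h := hsingle i (parabolicSimple cs (P i) ⟨s, hi⟩)
      rw [MonoidHom.comp_apply]
      refine (congrArg Ψ h).trans ?_
      exact Subgroup.noncommPiCoprod_mulSingle _ _
    exact Function.LeftInverse.injective (g := Ψ) (DFunLike.congr_fun hΨ)
  · rw [← MonoidHom.range_eq_top, eq_top_iff]
    exact fun x _ => Subgroup.pi_mem_of_mulSingle_mem x fun i => ⟨x i, hsingle i (x i)⟩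

end Components

section Decomposition

variable {M : CoxeterMatrix B} (cs : CoxeterSystem M W)

/-- The set of generators whose connected component spans a finite parabolic subgroup. -/
def finitePart : Set B :=
  {s | ¬ Infinite (standardParabolic cs ((coxeterGraph M).connectedComponentMk s).supp)}

lemma isComponentUnion_finitePart : IsComponentUnion M (finitePart cs) := by
  refine fun s hs t ht => eq_two_of_connectedComponentMk_ne fun h => ht ?_
  rw [finitePart, Set.mem_ofPred_eq] at hs ⊢
  rwa [← h]

lemma pairwise_disjoint_supp : Pairwise fun c c' : (coxeterGraph M).ConnectedComponent =>
    Disjoint c.supp c'.supp := by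
  refine fun c c' hcc' => Set.disjoint_left.mpr fun s hs hs' => hcc' ?_
  rw [SimpleGraph.ConnectedComponent.mem_supp_iff] at hs hs'
  rw [← hs, hs']

lemma disjoint_supp_finitePart (c : (coxeterGraph M).ConnectedComponent)
    [Infinite (standardParabolic cs c.supp)] : Disjoint c.supp (finitePart cs) := by
  refine Set.disjoint_left.mpr fun s hs hs' => hs' ?_
  rw [SimpleGraph.ConnectedComponent.mem_supp_iff] at hs
  rwa [hs]

instance [Finite B] : Finite (standardParabolic cs (finitePart cs)) := by
  have hbij := bijective_pi_parabolicProj cs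
    (isComponentUnion_supp (M := M)) pairwise_disjoint_supp fun s => ⟨_, rfl⟩
  have (c : {c : (coxeterGraph M).ConnectedComponent //
      ¬ Infinite (standardParabolic cs c.supp)}) : Finite (standardParabolic cs c.1.supp) :=
    not_infinite_iff_finite.mp c.2
  refine Finite.of_injective (β := ∀ c : {c : (coxeterGraph M).ConnectedComponent //
      ¬ Infinite (standardParabolic cs c.supp)}, standardParabolic cs c.1.supp)
    (fun x c => parabolicProj cs (isComponentUnion_supp c.1) x) fun x y hxy => ?_
  refine Subtype.ext (hbij.injective (funext fun c => ?_))
  by_cases hc : Infinite (standardParabolic cs c.supp)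
  · have hone := parabolicProj_eq_one cs (isComponentUnion_supp c) (disjoint_supp_finitePart cs c)
    exact (hone x).trans (hone y).symm
  · exact congrFun hxy ⟨c, hc⟩

/-- A Coxeter group is the direct product of its infinite irreducible components and of its
finite part. -/
theorem nonempty_mulEquiv_prod_finitePart {ι : Type*} [Finite ι]
    (X : ι → (coxeterGraph M).ConnectedComponent) (hX : Function.Injective X)
    (hXall : ∀ c : (coxeterGraph M).ConnectedComponent,
      Infinite (standardParabolic cs c.supp) ↔ ∃ i, X i = c) :
    Nonempty (W ≃* (∀ i, standardParabolic cs (X i).supp) ×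
      standardParabolic cs (finitePart cs)) := by
  have hinf (i : ι) : Infinite (standardParabolic cs (X i).supp) := (hXall _).mpr ⟨i, rfl⟩
  let P : Option ι → Set B := fun o => o.elim (finitePart cs) fun i => (X i).supp
  have hP : ∀ o, IsComponentUnion M (P o)
    | none => isComponentUnion_finitePart cs
    | some i => isComponentUnion_supp (X i)
  have hdisj : Pairwise fun o o' => Disjoint (P o) (P o')
    | none, none, h => (h rfl).elim
    | none, some i, _ => (disjoint_supp_finitePart cs (X i)).symm
    | some i, none, _ => disjoint_supp_finitePart cs (X i)
    | some i, some j, h => pairwise_disjoint_supp fun hij => h (congrArg some (hX hij))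
  have hcover (s : B) : ∃ o, s ∈ P o := by
    by_cases hs : s ∈ finitePart cs
    · exact ⟨none, hs⟩
    · obtain ⟨i, hi⟩ := (hXall _).mp (not_not.mp hs)
      exact ⟨some i, hi.symm⟩
  let e : (∀ o, standardParabolic cs (P o)) ≃*
      standardParabolic cs (finitePart cs) × ∀ i, standardParabolic cs (X i).supp :=
    { Equiv.piOptionEquivProd with map_mul' := fun _ _ => rfl }
  exact ⟨((MulEquiv.ofBijective _ (bijective_pi_parabolicProj cs hP hdisj hcover)).trans e).trans
    MulEquiv.prodComm⟩

end Decomposition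

/-- Componentwise isomorphic families of groups have isomorphic products. -/
def piMulEquivOfEquiv {ι κ : Type*} {A : ι → Type*} {A' : κ → Type*} [∀ i, Group (A i)]
    [∀ j, Group (A' j)] (σ : ι ≃ κ) (e : ∀ i, A i ≃* A' (σ i)) : (∀ i, A i) ≃* ∀ j, A' j :=
  { Equiv.piCongr σ fun i => (e i).toEquiv with
    map_mul' := fun x y => by
      refine funext fun j => ?_
      obtain ⟨i, rfl⟩ := σ.surjective j
      simp [Equiv.piCongr_apply_apply] }

/-- **Corollary 5.4.** Isomorphism criterion for Coxeter groups in terms of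
their infinite irreducible components and their finite parts. -/
theorem isomorphism_criterion
    [Fintype B] {M : CoxeterMatrix B} (cs : CoxeterSystem M W)
    {B' : Type*} [Fintype B'] {W' : Type*} [Group W'] {M' : CoxeterMatrix B'}
    (cs' : CoxeterSystem M' W')
    (b d : ℕ)
    (X : Fin b → (coxeterGraph M).ConnectedComponent)
    (hXinj : Function.Injective X)
    (hXall : ∀ c : (coxeterGraph M).ConnectedComponent,
      Infinite (standardParabolic cs c.supp) ↔ ∃ i, X i = c)
    (Z₃ : Set B)
    (hZ₃ : Z₃ = {s : B |
      ¬ Infinite (standardParabolic cs ((coxeterGraph M).connectedComponentMk s).supp)})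
    (X' : Fin d → (coxeterGraph M').ConnectedComponent)
    (hX'inj : Function.Injective X')
    (hX'all : ∀ c : (coxeterGraph M').ConnectedComponent,
      Infinite (standardParabolic cs' c.supp) ↔ ∃ i, X' i = c)
    (Z₃' : Set B')
    (hZ₃' : Z₃' = {s : B' |
      ¬ Infinite (standardParabolic cs' ((coxeterGraph M').connectedComponentMk s).supp)}) :
    Nonempty (W ≃* W') ↔
      (Nonempty (standardParabolic cs Z₃ ≃* standardParabolic cs' Z₃') ∧ b = d ∧
       ∃ σ : Fin b ≃ Fin d, ∀ i : Fin b,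
         Nonempty (standardParabolic cs (X i).supp ≃*
           standardParabolic cs' (X' (σ i)).supp)) := by
  subst hZ₃ hZ₃'
  have hA (i : Fin b) : IsStronglyIndecomposable (standardParabolic cs (X i).supp) :=
    have := (hXall (X i)).mpr ⟨i, rfl⟩
    isStronglyIndecomposable_standardParabolic cs (X i)
  have hA' (i : Fin d) : IsStronglyIndecomposable (standardParabolic cs' (X' i).supp) :=
    have := (hX'all (X' i)).mpr ⟨i, rfl⟩
    isStronglyIndecomposable_standardParabolic cs' (X' i)
  obtain ⟨e⟩ := nonempty_mulEquiv_prod_finitePart cs X hXinj hXall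
  obtain ⟨e'⟩ := nonempty_mulEquiv_prod_finitePart cs' X' hX'inj hX'all
  constructor
  · rintro ⟨f⟩
    obtain ⟨hF, ⟨θ⟩⟩ := nonempty_mulEquiv_of_prod (pi_eq_bot_of_finite_normal hA)
      (pi_eq_bot_of_finite_normal hA') ((e.symm.trans f).trans e')
    obtain ⟨σ, hσ⟩ := exists_equiv_of_pi_mulEquiv hA hA' θ
    exact ⟨hF, Fin.equiv_iff_eq.mp ⟨σ⟩, σ, hσ⟩
  · rintro ⟨⟨g⟩, -, σ, hσ⟩
    exact ⟨(e.trans ((piMulEquivOfEquiv σ fun i => (hσ i).some).prodCongr g)).trans e'.symm⟩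

end CoxeterPaper
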